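/- arXiv:1411.6149 — 2 statements merged into one kernel-verified Lean document; each statement's English description precedes it below -/
import Mathlib

section
/- For k = 2 and any fixed β with 0 ≤ β < 1, the sequence of laws P_β (the law of the random symmetric matrix X = β v v^T + Z, with v uniform on the unit sphere S^{n−1} and Z an independent n×n GOE matrix) is contiguous with respect to the sequence P_0 (the law of Z): for any sequence of measurable sets A_n of symmetric matrices, P_0(A_n) → 0 implies P_β(A_n) → 0 as n → ∞. -/
open MeasureTheory ProbabilityTheory Filter
open scoped ENNReal

noncomputable section

instance matrixMeasurableSpace {m n α : Type*} [MeasurableSpace α] :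
    MeasurableSpace (Matrix m n α) :=
  inferInstanceAs (MeasurableSpace (m → n → α))

/-- Product of i.i.d. standard Gaussians indexed by `ι`. -/
def stdGaussianPi (ι : Type*) [Fintype ι] : Measure (ι → ℝ) :=
  Measure.pi fun _ => gaussianReal 0 1

/-- GOE matrix law: `Z = (G + Gᵀ)/√(2n)` with `G` having i.i.d. `N(0,1)` entries; it is a
symmetric random matrix with independent upper-triangular entries `Z_ij ~ N(0,1/n)` for `i<j`
and `Z_ii ~ N(0,2/n)`. -/
def goe (n : ℕ) : Measure (Matrix (Fin n) (Fin n) ℝ) :=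
  (stdGaussianPi (Fin n × Fin n)).map
    fun g => Matrix.of fun i j => (g (i, j) + g (j, i)) / Real.sqrt (2 * n)

/-- The uniform (rotation-invariant) probability measure on the unit sphere `S^{n-1} ⊆ ℝⁿ`,
realized as the law of a normalized standard Gaussian vector. -/
def sphereUniform (n : ℕ) : Measure (EuclideanSpace ℝ (Fin n)) :=
  ((stdGaussianPi (Fin n)).map
      fun x => ((EuclideanSpace.equiv (Fin n) ℝ).symm x : EuclideanSpace ℝ (Fin n))).map
    fun v => ‖v‖⁻¹ • v

/-- Law of `β v vᵀ + Z` with `v` uniform on the unit sphere and `Z` an independent GOE matrix. -/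
def spikedGOE (n : ℕ) (β : ℝ) : Measure (Matrix (Fin n) (Fin n) ℝ) :=
  ((sphereUniform n).prod (goe n)).map
    fun p => Matrix.of fun i j => β * (p.1 i * p.1 j) + (p.2 : Matrix (Fin n) (Fin n) ℝ) i j

instance isProbabilityMeasure_stdGaussianPi (ι : Type*) [Fintype ι] :
    IsProbabilityMeasure (stdGaussianPi ι) := by
  unfold stdGaussianPi; infer_instance

/-- A product of measures with densities has the product of the densities as density. -/
lemma pi_withDensity_eq {ι : Type*} [Fintype ι] {X : ι → Type*} [∀ i, MeasurableSpace (X i)]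
    (μ : ∀ i, Measure (X i)) [∀ i, IsProbabilityMeasure (μ i)] (f : ∀ i, X i → ℝ≥0∞)
    (hf : ∀ i, Measurable (f i)) [∀ i, SigmaFinite ((μ i).withDensity (f i))] :
    Measure.pi (fun i => (μ i).withDensity (f i)) =
      (Measure.pi μ).withDensity (fun x => ∏ i, f i (x i)) := by
  classical
  refine Measure.pi_eq fun s hs => ?_
  rw [withDensity_apply _ (MeasurableSet.univ_pi hs),
    ← lintegral_indicator (MeasurableSet.univ_pi hs)]
  have hg : ∀ i, Measurable ((s i).indicator (f i)) := fun i => (hf i).indicator (hs i)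
  have hind : iIndepFun (fun i (x : ∀ i, X i) => (s i).indicator (f i) (x i)) (Measure.pi μ) :=
    iIndepFun_pi fun i => (hg i).aemeasurable
  have key := lintegral_prod_eq_prod_lintegral_of_indepFun Finset.univ _ hind
    (fun i => (hg i).comp (measurable_pi_apply i))
  have hpt : ∀ x : ∀ i, X i, (Set.pi Set.univ s).indicator (fun x => ∏ i, f i (x i)) x
      = ∏ i, (s i).indicator (f i) (x i) := by
    intro x
    by_cases hx : x ∈ Set.pi Set.univ s
    · rw [Set.indicator_of_mem hx]
      exact Finset.prod_congr rfl fun i _ => (Set.indicator_of_mem (hx i trivial) _).symm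
    · rw [Set.indicator_of_notMem hx]
      simp only [Set.mem_pi, Set.mem_univ, forall_const, not_forall] at hx
      obtain ⟨i, hi⟩ := hx
      exact (Finset.prod_eq_zero (Finset.mem_univ i) (Set.indicator_of_notMem hi _)).symm
  simp_rw [hpt, key]
  refine Finset.prod_congr rfl fun i _ => ?_
  rw [withDensity_apply _ (hs i), ← lintegral_indicator (hs i)]
  exact (measurePreserving_eval μ i).lintegral_comp (hg i)

/-- The density of a Gaussian measure with respect to the standard one. -/
lemma gaussianReal_eq_withDensity {m : ℝ} {v : NNReal} (hv : v ≠ 0) {f : ℝ → ℝ}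
    (hf : Measurable f)
    (h : ∀ x, gaussianPDFReal m v x = gaussianPDFReal 0 1 x * f x) :
    gaussianReal m v = (gaussianReal 0 1).withDensity (fun x => ENNReal.ofReal (f x)) := by
  rw [gaussianReal_of_var_ne_zero _ hv, gaussianReal_of_var_ne_zero _ one_ne_zero,
    ← withDensity_mul _ (measurable_gaussianPDF _ _) (by fun_prop)]
  congr 1
  ext x
  simp only [gaussianPDF, Pi.mul_apply]
  rw [h, ENNReal.ofReal_mul (gaussianPDFReal_nonneg _ _ _)]

lemma gaussianReal_map_add_eq_withDensity (m : ℝ) :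
    (gaussianReal 0 1).map (fun x => x + m) =
      (gaussianReal 0 1).withDensity (fun x => ENNReal.ofReal (Real.exp (m * x - m ^ 2 / 2))) := by
  rw [gaussianReal_map_add_const]
  refine gaussianReal_eq_withDensity one_ne_zero (by fun_prop) fun x => ?_
  simp only [gaussianPDFReal, mul_assoc, ← Real.exp_add]
  congr 2
  push_cast
  ring

lemma gaussianReal_map_inv_mul_eq_withDensity {a : ℝ} (ha : 0 < a) :
    (gaussianReal 0 1).map (fun x => a⁻¹ * x) =
      (gaussianReal 0 1).withDensity
        (fun x => ENNReal.ofReal (a * Real.exp (-((a ^ 2 - 1) / 2 * x ^ 2)))) := by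
  rw [gaussianReal_map_const_mul]
  refine gaussianReal_eq_withDensity ?_ (by fun_prop) fun x => ?_
  · simp only [mul_one, ne_eq]
    rw [← NNReal.coe_inj]
    simp [ha.ne']
  have h1 : √(2 * Real.pi * (a⁻¹) ^ 2) = √(2 * Real.pi) * a⁻¹ := by
    rw [Real.sqrt_mul (by positivity), Real.sqrt_sq (by positivity)]
  simp only [gaussianPDFReal, mul_one, NNReal.coe_mk, NNReal.coe_one, h1, mul_zero, sub_zero]
  have h2 : -x ^ 2 / (2 * a⁻¹ ^ 2) = -x ^ 2 / 2 + -((a ^ 2 - 1) / 2 * x ^ 2) := by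
    field_simp; ring
  rw [h2, Real.exp_add]
  field_simp

/-- The Gaussian likelihood ratio of a shift by `m`. -/
def shiftDensity {ι : Type*} [Fintype ι] (m g : ι → ℝ) : ℝ≥0∞ :=
  ENNReal.ofReal (Real.exp (∑ i, m i * g i - ∑ i, m i ^ 2 / 2))

/-- The Cameron–Martin formula for the standard Gaussian measure. -/
lemma lintegral_stdGaussianPi_add {ι : Type*} [Fintype ι] (m : ι → ℝ) {f : (ι → ℝ) → ℝ≥0∞}
    (hf : Measurable f) :
    ∫⁻ x, f (x + m) ∂stdGaussianPi ι =
      ∫⁻ x, shiftDensity m x * f x ∂stdGaussianPi ι := by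
  have hmap : (stdGaussianPi ι).map (fun x => x + m) = (stdGaussianPi ι).withDensity
      (fun x => ENNReal.ofReal (Real.exp (∑ i, m i * x i - ∑ i, m i ^ 2 / 2))) := by
    have hσ : ∀ i, IsProbabilityMeasure ((gaussianReal 0 1).withDensity
        (fun x => ENNReal.ofReal (Real.exp (m i * x - m i ^ 2 / 2)))) := fun i => by
      rw [← gaussianReal_map_add_eq_withDensity]
      exact Measure.isProbabilityMeasure_map (by fun_prop)
    have hσ' : ∀ i, IsProbabilityMeasure ((gaussianReal 0 1).map (fun x => x + m i)) := fun i =>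
      Measure.isProbabilityMeasure_map (by fun_prop)
    have h1 := Measure.pi_map_pi (μ := fun _ : ι => gaussianReal 0 1)
      (f := fun i x => x + m i) (fun i => by fun_prop)
    have h2 := pi_withDensity_eq (fun _ : ι => gaussianReal 0 1)
      (fun i x => ENNReal.ofReal (Real.exp (m i * x - m i ^ 2 / 2))) (fun i => by fun_prop)
    simp_rw [gaussianReal_map_add_eq_withDensity] at h1
    rw [h2] at h1
    refine h1.trans ?_
    unfold stdGaussianPi
    congr 1
    ext x
    rw [← ENNReal.ofReal_prod_of_nonneg (fun i _ => (Real.exp_pos _).le), ← Real.exp_sum,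
      Finset.sum_sub_distrib]
  rw [← lintegral_map hf (by fun_prop), hmap, lintegral_withDensity_eq_lintegral_mul _
    (by fun_prop) hf]
  rfl

/-- The moment generating function of the standard Gaussian measure. -/
lemma lintegral_exp_stdGaussianPi {ι : Type*} [Fintype ι] (m : ι → ℝ) :
    ∫⁻ x, ENNReal.ofReal (Real.exp (∑ i, m i * x i)) ∂stdGaussianPi ι =
      ENNReal.ofReal (Real.exp (∑ i, m i ^ 2 / 2)) := by
  have h := lintegral_stdGaussianPi_add m (f := fun _ => 1) measurable_const
  simp only [lintegral_const, measure_univ, mul_one, shiftDensity] at h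
  have : ∀ x : ι → ℝ, ENNReal.ofReal (Real.exp (∑ i, m i * x i)) =
      ENNReal.ofReal (Real.exp (∑ i, m i ^ 2 / 2)) *
        ENNReal.ofReal (Real.exp (∑ i, m i * x i - ∑ i, m i ^ 2 / 2)) := fun x => by
    rw [← ENNReal.ofReal_mul (Real.exp_pos _).le, ← Real.exp_add]
    congr 2; ring
  simp_rw [this]
  rw [lintegral_const_mul _ (by fun_prop), ← h, mul_one]

lemma lintegral_exp_gaussianReal (t : ℝ) :
    ∫⁻ x, ENNReal.ofReal (Real.exp (t * x)) ∂gaussianReal 0 1 =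
      ENNReal.ofReal (Real.exp (t ^ 2 / 2)) := by
  rw [← ofReal_integral_eq_lintegral_ofReal (integrable_exp_mul_gaussianReal t)
    (ae_of_all _ fun _ => (Real.exp_pos _).le)]
  have := congrFun (mgf_fun_id_gaussianReal (μ := 0) (v := 1)) t
  simp only [mgf] at this
  rw [this]
  simp

lemma lintegral_exp_sq_gaussianReal_lt_top {c : ℝ} (hc : c < 1 / 2) :
    ∫⁻ x, ENNReal.ofReal (Real.exp (c * x ^ 2)) ∂gaussianReal 0 1 < ∞ := by
  rw [gaussianReal_of_var_ne_zero _ one_ne_zero,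
    lintegral_withDensity_eq_lintegral_mul _ (measurable_gaussianPDF _ _) (by fun_prop)]
  have hint : Integrable (fun x : ℝ => (√(2 * Real.pi))⁻¹ * Real.exp (-(1 / 2 - c) * x ^ 2)) :=
    (integrable_exp_neg_mul_sq (by linarith)).const_mul _
  refine lt_of_eq_of_lt (lintegral_congr fun x => ?_) hint.lintegral_lt_top
  simp only [Pi.mul_apply, gaussianPDF]
  rw [← ENNReal.ofReal_mul (gaussianPDFReal_nonneg _ _ _)]
  simp only [gaussianPDFReal, NNReal.coe_one, mul_one, sub_zero, mul_assoc, ← Real.exp_add]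
  congr 3
  ring

/-- Projections of a standard Gaussian vector onto vectors of norm at most one have exponential
square moments dominated by those of a standard Gaussian variable. -/
lemma lintegral_exp_sq_inner_stdGaussianPi_le {ι : Type*} [Fintype ι] {c : ℝ} (hc : 0 ≤ c)
    (w : ι → ℝ) (hw : ∑ i, w i ^ 2 ≤ 1) :
    ∫⁻ x, ENNReal.ofReal (Real.exp (c * (∑ i, w i * x i) ^ 2)) ∂stdGaussianPi ι ≤
      ∫⁻ g, ENNReal.ofReal (Real.exp (c * g ^ 2)) ∂gaussianReal 0 1 := by
  have h2c : √(2 * c) ^ 2 = 2 * c := Real.sq_sqrt (by positivity)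
  calc ∫⁻ x, ENNReal.ofReal (Real.exp (c * (∑ i, w i * x i) ^ 2)) ∂stdGaussianPi ι
      = ∫⁻ x, ∫⁻ g, ENNReal.ofReal (Real.exp (√(2 * c) * (∑ i, w i * x i) * g)) ∂gaussianReal 0 1
          ∂stdGaussianPi ι := by
        refine lintegral_congr fun x => ?_
        rw [lintegral_exp_gaussianReal]
        congr 2
        rw [mul_pow, h2c]; ring
    _ = ∫⁻ g, ∫⁻ x, ENNReal.ofReal (Real.exp (√(2 * c) * (∑ i, w i * x i) * g)) ∂stdGaussianPi ι
          ∂gaussianReal 0 1 := lintegral_lintegral_swap (by fun_prop)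
    _ ≤ _ := by
        refine lintegral_mono fun g => ?_
        have : ∀ x : ι → ℝ, √(2 * c) * (∑ i, w i * x i) * g = ∑ i, (√(2 * c) * g * w i) * x i :=
          fun x => by
            rw [Finset.mul_sum, Finset.sum_mul]
            exact Finset.sum_congr rfl fun i _ => by ring
        simp_rw [this]
        rw [lintegral_exp_stdGaussianPi]
        refine ENNReal.ofReal_le_ofReal (Real.exp_le_exp.2 ?_)
        have : ∑ i, (√(2 * c) * g * w i) ^ 2 / 2 = c * g ^ 2 * ∑ i, w i ^ 2 := by
          rw [Finset.mul_sum]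
          refine Finset.sum_congr rfl fun i _ => ?_
          rw [mul_pow, mul_pow, h2c]; ring
        rw [this]
        exact mul_le_of_le_one_right (by positivity) hw

/-- Scaling formula for the standard Gaussian measure. -/
lemma integral_stdGaussianPi_inv_smul {ι : Type*} [Fintype ι] {a : ℝ} (ha : 0 < a)
    {h : (ι → ℝ) → ℝ} (hh : Measurable h) :
    ∫ x, h (a⁻¹ • x) ∂stdGaussianPi ι =
      a ^ Fintype.card ι *
        ∫ x, Real.exp (-((a ^ 2 - 1) / 2 * ∑ i, x i ^ 2)) * h x ∂stdGaussianPi ι := by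
  have hmap : (stdGaussianPi ι).map (fun x => a⁻¹ • x) = (stdGaussianPi ι).withDensity
      (fun x => ENNReal.ofReal
        (a ^ Fintype.card ι * Real.exp (-((a ^ 2 - 1) / 2 * ∑ i, x i ^ 2)))) := by
    have hσ : IsProbabilityMeasure ((gaussianReal 0 1).withDensity
        (fun x => ENNReal.ofReal (a * Real.exp (-((a ^ 2 - 1) / 2 * x ^ 2))))) := by
      rw [← gaussianReal_map_inv_mul_eq_withDensity ha]
      exact Measure.isProbabilityMeasure_map (by fun_prop)
    have hσ' : IsProbabilityMeasure ((gaussianReal 0 1).map (fun x => a⁻¹ * x)) :=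
      Measure.isProbabilityMeasure_map (by fun_prop)
    have h1 := Measure.pi_map_pi (μ := fun _ : ι => gaussianReal 0 1)
      (f := fun _ x => a⁻¹ * x) (fun i => by fun_prop)
    have h2 := pi_withDensity_eq (fun _ : ι => gaussianReal 0 1)
      (fun _ x => ENNReal.ofReal (a * Real.exp (-((a ^ 2 - 1) / 2 * x ^ 2))))
      (fun i => by fun_prop)
    simp_rw [gaussianReal_map_inv_mul_eq_withDensity ha] at h1
    rw [h2] at h1
    refine h1.trans ?_
    unfold stdGaussianPi
    congr 1
    ext x
    rw [← ENNReal.ofReal_prod_of_nonneg (fun i _ => by positivity), Finset.prod_mul_distrib,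
      ← Real.exp_sum, Finset.prod_const, Finset.card_univ, Finset.sum_neg_distrib,
      Finset.mul_sum]
  rw [← integral_map (φ := fun x : ι → ℝ => a⁻¹ • x) (by fun_prop) hh.aestronglyMeasurable, hmap,
    integral_withDensity_eq_integral_toReal_smul (by fun_prop)
      (ae_of_all _ fun _ => ENNReal.ofReal_lt_top), ← integral_const_mul]
  refine integral_congr_ae (ae_of_all _ fun x => ?_)
  simp only [smul_eq_mul]
  rw [ENNReal.toReal_ofReal (by positivity), mul_assoc]

lemma integrable_sum_sq_stdGaussianPi (ι : Type*) [Fintype ι] :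
    Integrable (fun x : ι → ℝ => ∑ i, x i ^ 2) (stdGaussianPi ι) := by
  refine integrable_finsetSum _ fun i _ => ?_
  unfold stdGaussianPi
  exact integrable_comp_eval (μ := fun _ : ι => gaussianReal 0 1) (f := fun y : ℝ => y ^ 2)
    (memLp_id_gaussianReal 2).integrable_sq

/-- The squared norm of a standard Gaussian vector is uncorrelated with every bounded function
of its direction. -/
lemma integral_sum_sq_mul_stdGaussianPi {ι : Type*} [Fintype ι] {h : (ι → ℝ) → ℝ}
    (hh : Measurable h) (h0 : ∀ x, 0 ≤ h x) {B : ℝ} (hB : ∀ x, h x ≤ B)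
    (hs : ∀ a : ℝ, 0 < a → ∀ x, h (a • x) = h x) :
    ∫ x, (∑ i, x i ^ 2) * h x ∂stdGaussianPi ι =
      Fintype.card ι * ∫ x, h x ∂stdGaussianPi ι := by
  set N := Fintype.card ι
  set M := ∫ x, h x ∂stdGaussianPi ι with hM
  set R := ∫ x, (∑ i, x i ^ 2) * h x ∂stdGaussianPi ι with hR
  have hhi : Integrable h (stdGaussianPi ι) :=
    Integrable.of_bound hh.aestronglyMeasurable B
      (ae_of_all _ fun x => by rw [Real.norm_of_nonneg (h0 x)]; exact hB x)
  have hRi : Integrable (fun x => (∑ i, x i ^ 2) * h x) (stdGaussianPi ι) :=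
    (integrable_sum_sq_stdGaussianPi ι).mul_bdd (c := B) hh.aestronglyMeasurable
      (ae_of_all _ fun x => by rw [Real.norm_of_nonneg (h0 x)]; exact hB x)
  have hle : ∀ a : ℝ, 0 < a → M ≤ (a ^ N)⁻¹ * M + (a ^ 2 - 1) / 2 * R := by
    intro a ha
    have h1 := integral_stdGaussianPi_inv_smul ha hh
    simp_rw [hs _ (inv_pos.2 ha)] at h1
    rw [← hM] at h1
    have h2 : (a ^ N)⁻¹ * M =
        ∫ x, Real.exp (-((a ^ 2 - 1) / 2 * ∑ i, x i ^ 2)) * h x ∂stdGaussianPi ι := by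
      rw [h1, inv_mul_cancel_left₀ (by positivity)]
    by_cases hi : Integrable
        (fun x => Real.exp (-((a ^ 2 - 1) / 2 * ∑ i, x i ^ 2)) * h x) (stdGaussianPi ι)
    · rw [h2, hR, ← integral_const_mul, ← integral_add hi (hRi.const_mul _)]
      refine integral_mono hhi (hi.add (hRi.const_mul _)) fun x => ?_
      have h3 := Real.add_one_le_exp (-((a ^ 2 - 1) / 2 * ∑ i, x i ^ 2))
      have h4 := mul_le_mul_of_nonneg_right h3 (h0 x)
      simp only
      linarith
    · rw [integral_undef hi] at h2
      have hM0 : M = 0 := by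
        rcases mul_eq_zero.1 h2 with h | h
        · exact absurd h (by positivity)
        · exact h
      have hae : h =ᵐ[stdGaussianPi ι] 0 := (integral_eq_zero_iff_of_nonneg h0 hhi).1 hM0
      exact absurd ((integrable_zero _ _ _).congr (by
        filter_upwards [hae] with x hx
        simp [hx])) hi
  have hd : HasDerivAt (fun a : ℝ => (a ^ N)⁻¹ * M + (a ^ 2 - 1) / 2 * R) (-N * M + R) 1 := by
    have e1 := ((hasDerivAt_pow N (1 : ℝ)).inv (by simp)).mul_const M
    have e2 := (((hasDerivAt_pow 2 (1 : ℝ)).sub_const 1).div_const 2).mul_const R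
    refine (e1.add e2).congr_deriv ?_
    simp
  have hmin : IsLocalMin (fun a : ℝ => (a ^ N)⁻¹ * M + (a ^ 2 - 1) / 2 * R) 1 := by
    filter_upwards [lt_mem_nhds (zero_lt_one (α := ℝ))] with a ha
    simpa using hle a ha
  linarith [hmin.hasDerivAt_eq_zero hd]

/-- The exponential square moments of a coordinate of a uniform point on the sphere are dominated
by those of a standard Gaussian variable. -/
lemma lintegral_exp_card_mul_sq_div_le {ι : Type*} [Fintype ι] {c : ℝ} (hc : 0 ≤ c)
    (hc' : c < 1 / 2) (w : ι → ℝ) (hw : ∑ i, w i ^ 2 ≤ 1) :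
    ∫⁻ x, ENNReal.ofReal (Real.exp
        (c * Fintype.card ι * ((∑ i, w i * x i) ^ 2 / ∑ i, x i ^ 2))) ∂stdGaussianPi ι ≤
      ∫⁻ g, ENNReal.ofReal (Real.exp (c * g ^ 2)) ∂gaussianReal 0 1 := by
  refine le_trans ?_ (lintegral_exp_sq_inner_stdGaussianPi_le hc w hw)
  have hfin := (lintegral_exp_sq_inner_stdGaussianPi_le hc w hw).trans_lt
    (lintegral_exp_sq_gaussianReal_lt_top hc')
  set N := Fintype.card ι
  set q : (ι → ℝ) → ℝ := fun x => (∑ i, w i * x i) ^ 2 / ∑ i, x i ^ 2 with hq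
  have hr0 : ∀ x : ι → ℝ, 0 ≤ ∑ i, x i ^ 2 := fun x => Finset.sum_nonneg fun i _ => sq_nonneg _
  have hcs : ∀ x : ι → ℝ, (∑ i, w i * x i) ^ 2 ≤ ∑ i, x i ^ 2 := fun x =>
    (Finset.sum_mul_sq_le_sq_mul_sq _ _ _).trans (mul_le_of_le_one_left (hr0 x) hw)
  have hq0 : ∀ x, 0 ≤ q x := fun x => div_nonneg (sq_nonneg _) (hr0 x)
  have hq1 : ∀ x, q x ≤ 1 := fun x => div_le_one_of_le₀ (hcs x) (hr0 x)
  have hqr : ∀ x, (∑ i, x i ^ 2) * q x = (∑ i, w i * x i) ^ 2 := fun x => by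
    rcases eq_or_ne (∑ i, x i ^ 2) 0 with h | h
    · rw [h, zero_mul]
      exact le_antisymm (sq_nonneg _) (h ▸ hcs x)
    · exact mul_div_cancel₀ _ h
  have hqs : ∀ a : ℝ, 0 < a → ∀ x, q (a • x) = q x := fun a ha x => by
    have h1 : ∑ i, w i * (a • x) i = a * ∑ i, w i * x i := by
      rw [Finset.mul_sum]
      exact Finset.sum_congr rfl fun i _ => by simp only [Pi.smul_apply, smul_eq_mul]; ring
    have h2 : ∑ i, (a • x) i ^ 2 = a ^ 2 * ∑ i, x i ^ 2 := by
      rw [Finset.mul_sum]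
      exact Finset.sum_congr rfl fun i _ => by simp only [Pi.smul_apply, smul_eq_mul]; ring
    simp only [hq, h1, h2, mul_pow]
    exact mul_div_mul_left _ _ (by positivity)
  have hqm : Measurable q := by fun_prop
  set h : (ι → ℝ) → ℝ := fun x => Real.exp (c * N * q x) * (c * q x) with hh
  have hhm : Measurable h := by fun_prop
  have hexp : ∀ x, Real.exp (c * N * q x) ≤ Real.exp (c * N) := fun x =>
    Real.exp_le_exp.2 (mul_le_of_le_one_right (by positivity) (hq1 x))
  have hh0 : ∀ x, 0 ≤ h x := fun x => mul_nonneg (Real.exp_pos _).le (mul_nonneg hc (hq0 x))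
  have hhB : ∀ x, h x ≤ Real.exp (c * N) * c := fun x =>
    mul_le_mul (hexp x) (mul_le_of_le_one_right hc (hq1 x)) (mul_nonneg hc (hq0 x))
      (Real.exp_pos _).le
  have hkey := integral_sum_sq_mul_stdGaussianPi hhm hh0 hhB
    (fun a ha x => by simp only [hh, hqs a ha x])
  have hhi : Integrable h (stdGaussianPi ι) :=
    Integrable.of_bound hhm.aestronglyMeasurable (Real.exp (c * N) * c)
      (ae_of_all _ fun x => by rw [Real.norm_of_nonneg (hh0 x)]; exact hhB x)
  have hRi : Integrable (fun x => (∑ i, x i ^ 2) * h x) (stdGaussianPi ι) :=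
    (integrable_sum_sq_stdGaussianPi ι).mul_bdd (c := Real.exp (c * N) * c)
      hhm.aestronglyMeasurable
      (ae_of_all _ fun x => by rw [Real.norm_of_nonneg (hh0 x)]; exact hhB x)
  have hEi : Integrable (fun x => Real.exp (c * N * q x)) (stdGaussianPi ι) :=
    Integrable.of_bound (by fun_prop) (Real.exp (c * N))
      (ae_of_all _ fun x => by rw [Real.norm_of_nonneg (Real.exp_pos _).le]; exact hexp x)
  have hGi : Integrable (fun x : ι → ℝ => Real.exp (c * (∑ i, w i * x i) ^ 2))
      (stdGaussianPi ι) :=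
    (lintegral_ofReal_ne_top_iff_integrable (Measurable.aestronglyMeasurable (by fun_prop))
      (ae_of_all _ fun _ => (Real.exp_pos _).le)).1 hfin.ne
  rw [← ofReal_integral_eq_lintegral_ofReal hEi (ae_of_all _ fun _ => (Real.exp_pos _).le),
    ← ofReal_integral_eq_lintegral_ofReal hGi (ae_of_all _ fun _ => (Real.exp_pos _).le)]
  refine ENNReal.ofReal_le_ofReal ?_
  have hlin : ∫ x, (Real.exp (c * N * q x) + ((∑ i, x i ^ 2) * h x - N * h x)) ∂stdGaussianPi ι
      = ∫ x, Real.exp (c * N * q x) ∂stdGaussianPi ι := by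
    rw [integral_add (g := fun x => (∑ i, x i ^ 2) * h x - N * h x) hEi
        (hRi.sub (hhi.const_mul (N : ℝ))),
      integral_sub hRi (hhi.const_mul (N : ℝ)), hkey, integral_const_mul, sub_self, add_zero]
  rw [← hlin]
  refine integral_mono (hEi.add (hRi.sub (hhi.const_mul _))) hGi fun x => ?_
  have h1 := Real.add_one_le_exp (c * q x * ((∑ i, x i ^ 2) - N))
  have h2 := mul_le_mul_of_nonneg_left h1 (Real.exp_pos (c * N * q x)).le
  rw [← Real.exp_add] at h2
  have h3 : c * N * q x + c * q x * ((∑ i, x i ^ 2) - N) = c * (∑ i, w i * x i) ^ 2 := by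
    rw [← hqr x]; ring
  rw [h3] at h2
  simp only [hh]
  linarith

/-- The direction of a vector. -/
def direction {ι : Type*} [Fintype ι] (x : ι → ℝ) (i : ι) : ℝ :=
  (√(∑ j, x j ^ 2))⁻¹ * x i

@[fun_prop]
lemma measurable_direction {ι : Type*} [Fintype ι] :
    Measurable (direction : (ι → ℝ) → ι → ℝ) := by
  unfold direction
  fun_prop

lemma sum_direction_sq_le_one {ι : Type*} [Fintype ι] (x : ι → ℝ) :
    ∑ i, direction x i ^ 2 ≤ 1 := by
  have h0 : 0 ≤ ∑ j, x j ^ 2 := Finset.sum_nonneg fun j _ => sq_nonneg _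
  simp only [direction, mul_pow, ← Finset.mul_sum, inv_pow, Real.sq_sqrt h0]
  rw [inv_mul_eq_div]
  exact div_self_le_one _

lemma sum_mul_direction_sq {ι : Type*} [Fintype ι] (w x : ι → ℝ) :
    (∑ i, w i * direction x i) ^ 2 = (∑ i, w i * x i) ^ 2 / ∑ i, x i ^ 2 := by
  have h0 : 0 ≤ ∑ j, x j ^ 2 := Finset.sum_nonneg fun j _ => sq_nonneg _
  have h1 : ∑ i, w i * direction x i = (√(∑ j, x j ^ 2))⁻¹ * ∑ i, w i * x i := by
    rw [Finset.mul_sum]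
    exact Finset.sum_congr rfl fun i _ => by rw [direction]; ring
  rw [h1, mul_pow, inv_pow, Real.sq_sqrt h0, inv_mul_eq_div]

/-- The symmetrization map whose image of the standard Gaussian measure is the GOE law. -/
def symmetrize (n : ℕ) (g : Fin n × Fin n → ℝ) : Matrix (Fin n) (Fin n) ℝ :=
  Matrix.of fun i j => (g (i, j) + g (j, i)) / Real.sqrt (2 * n)

lemma measurable_symmetrize (n : ℕ) : Measurable (symmetrize n) := by
  refine measurable_pi_lambda _ fun i => measurable_pi_lambda _ fun j => ?_
  simp only [symmetrize, Matrix.of_apply]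
  fun_prop

lemma goe_apply {n : ℕ} {A : Set (Matrix (Fin n) (Fin n) ℝ)} (hA : MeasurableSet A) :
    goe n A = stdGaussianPi (Fin n × Fin n) (symmetrize n ⁻¹' A) :=
  Measure.map_apply (measurable_symmetrize n) hA

/-- The rank-one shift of the Gaussian array that produces the spike. -/
def spike (n : ℕ) (β : ℝ) (x : Fin n → ℝ) (p : Fin n × Fin n) : ℝ :=
  β * √(n / 2) * (direction x p.1 * direction x p.2)

@[fun_prop]
lemma measurable_spike (n : ℕ) (β : ℝ) : Measurable (spike n β) := by
  unfold spike
  fun_prop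

lemma sum_spike_mul_spike (n : ℕ) (β : ℝ) (x y : Fin n → ℝ) :
    ∑ p, spike n β x p * spike n β y p =
      β ^ 2 / 2 * n * (∑ i, direction x i * direction y i) ^ 2 := by
  have h : √((n : ℝ) / 2) ^ 2 = n / 2 := Real.sq_sqrt (by positivity)
  rw [Fintype.sum_prod_type, sq (∑ i, _), Finset.sum_mul_sum, Finset.mul_sum]
  refine Finset.sum_congr rfl fun i _ => ?_
  rw [Finset.mul_sum]
  refine Finset.sum_congr rfl fun j _ => ?_
  simp only [spike]
  linear_combination (β ^ 2 * (direction x i * direction x j) *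
    (direction y i * direction y j)) * h

lemma symmetrize_add_spike {n : ℕ} (hn : n ≠ 0) (β : ℝ) (x : Fin n → ℝ)
    (g : Fin n × Fin n → ℝ) :
    symmetrize n (g + spike n β x) =
      Matrix.of fun i j => β * (direction x i * direction x j) + symmetrize n g i j := by
  have hn' : (0 : ℝ) < n := by exact_mod_cast Nat.pos_of_ne_zero hn
  have h1 : √(2 * (n : ℝ)) = 2 * √((n : ℝ) / 2) := by
    rw [show (2 : ℝ) * n = 2 ^ 2 * (n / 2) by ring, Real.sqrt_mul (by positivity),
      Real.sqrt_sq (by norm_num)]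
  have h2 : √((n : ℝ) / 2) ≠ 0 := (Real.sqrt_pos.2 (by positivity)).ne'
  ext i j
  simp only [symmetrize, Matrix.of_apply, Pi.add_apply, spike, h1]
  field_simp
  ring

/-- The matrix `Z` with the rank-one spike `β v vᵀ` added. -/
def addRankOne (n : ℕ) (β : ℝ) (v : EuclideanSpace ℝ (Fin n)) (Z : Matrix (Fin n) (Fin n) ℝ) :
    Matrix (Fin n) (Fin n) ℝ :=
  Matrix.of fun i j => β * (v i * v j) + Z i j

lemma measurable_addRankOne (n : ℕ) (β : ℝ) :
    Measurable fun p : EuclideanSpace ℝ (Fin n) × Matrix (Fin n) (Fin n) ℝ =>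
      addRankOne n β p.1 p.2 := by
  refine measurable_pi_lambda _ fun i => measurable_pi_lambda _ fun j => ?_
  have h2 : Measurable fun p : EuclideanSpace ℝ (Fin n) × Matrix (Fin n) (Fin n) ℝ => p.2 i j :=
    (measurable_pi_apply j).comp ((measurable_pi_apply i).comp measurable_snd)
  simp only [addRankOne, Matrix.of_apply]
  fun_prop

lemma spikedGOE_apply {n : ℕ} (hn : n ≠ 0) (β : ℝ) {A : Set (Matrix (Fin n) (Fin n) ℝ)}
    (hA : MeasurableSet A) :
    spikedGOE n β A = ∫⁻ x, ∫⁻ g, (symmetrize n ⁻¹' A).indicator 1 (g + spike n β x)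
      ∂stdGaussianPi (Fin n × Fin n) ∂stdGaussianPi (Fin n) := by
  have hF := measurable_addRankOne n β
  have hind : Measurable (A.indicator (1 : Matrix (Fin n) (Fin n) ℝ → ℝ≥0∞)) :=
    measurable_one.indicator hA
  have hG : Measurable fun p : EuclideanSpace ℝ (Fin n) × Matrix (Fin n) (Fin n) ℝ =>
      A.indicator (1 : Matrix (Fin n) (Fin n) ℝ → ℝ≥0∞) (addRankOne n β p.1 p.2) :=
    hind.comp hF
  have he : Measurable fun x : Fin n → ℝ =>
      ((EuclideanSpace.equiv (Fin n) ℝ).symm x : EuclideanSpace ℝ (Fin n)) :=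
    (EuclideanSpace.equiv (Fin n) ℝ).symm.continuous.measurable
  have hnorm : Measurable fun v : EuclideanSpace ℝ (Fin n) => ‖v‖⁻¹ • v := by fun_prop
  have hgoe : goe n = (stdGaussianPi (Fin n × Fin n)).map (symmetrize n) := rfl
  have hspiked : spikedGOE n β =
      ((sphereUniform n).prod (goe n)).map fun p => addRankOne n β p.1 p.2 := rfl
  have : IsProbabilityMeasure (goe n) :=
    hgoe ▸ Measure.isProbabilityMeasure_map (measurable_symmetrize n).aemeasurable
  have hin : Measurable fun v : EuclideanSpace ℝ (Fin n) =>
      ∫⁻ Z, A.indicator (1 : Matrix (Fin n) (Fin n) ℝ → ℝ≥0∞) (addRankOne n β v Z) ∂goe n :=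
    hG.lintegral_prod_right'
  have hin' : Measurable fun v : EuclideanSpace ℝ (Fin n) =>
      ∫⁻ Z, A.indicator (1 : Matrix (Fin n) (Fin n) ℝ → ℝ≥0∞)
        (addRankOne n β (‖v‖⁻¹ • v) Z) ∂goe n :=
    hin.comp hnorm
  rw [← lintegral_indicator_one hA, hspiked, lintegral_map hind hF,
    lintegral_prod _ hG.aemeasurable, sphereUniform, lintegral_map hin hnorm,
    lintegral_map hin' he]
  refine lintegral_congr fun x => ?_
  have hdir : ∀ i, (‖(EuclideanSpace.equiv (Fin n) ℝ).symm x‖⁻¹ •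
      (EuclideanSpace.equiv (Fin n) ℝ).symm x : EuclideanSpace ℝ (Fin n)) i = direction x i := by
    intro i
    simp [direction, EuclideanSpace.norm_eq]
  have hGx : Measurable fun Z => A.indicator (1 : Matrix (Fin n) (Fin n) ℝ → ℝ≥0∞)
      (addRankOne n β (‖(EuclideanSpace.equiv (Fin n) ℝ).symm x‖⁻¹ •
        (EuclideanSpace.equiv (Fin n) ℝ).symm x) Z) :=
    hG.comp measurable_prodMk_left
  rw [hgoe, lintegral_map hGx (measurable_symmetrize n)]
  refine lintegral_congr fun g => ?_
  have hpt : addRankOne n β (‖(EuclideanSpace.equiv (Fin n) ℝ).symm x‖⁻¹ •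
      (EuclideanSpace.equiv (Fin n) ℝ).symm x) (symmetrize n g) =
        symmetrize n (g + spike n β x) := by
    rw [symmetrize_add_spike hn]
    simp only [addRankOne, hdir]
  rw [hpt]
  rfl

lemma lintegral_shiftDensity_mul {ι : Type*} [Fintype ι] (m m' : ι → ℝ) :
    ∫⁻ g, shiftDensity m g * shiftDensity m' g ∂stdGaussianPi ι =
      ENNReal.ofReal (Real.exp (∑ i, m i * m' i)) := by
  have h : ∀ g : ι → ℝ, shiftDensity m g * shiftDensity m' g =
      ENNReal.ofReal (Real.exp (-(∑ i, m i ^ 2 / 2 + ∑ i, m' i ^ 2 / 2))) *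
        ENNReal.ofReal (Real.exp (∑ i, (m i + m' i) * g i)) := fun g => by
    rw [shiftDensity, shiftDensity, ← ENNReal.ofReal_mul (Real.exp_pos _).le,
      ← ENNReal.ofReal_mul (Real.exp_pos _).le, ← Real.exp_add, ← Real.exp_add]
    congr 2
    simp only [add_mul, Finset.sum_add_distrib]
    ring
  simp_rw [h]
  rw [lintegral_const_mul _ (by fun_prop), lintegral_exp_stdGaussianPi,
    ← ENNReal.ofReal_mul (Real.exp_pos _).le, ← Real.exp_add]
  congr 2
  rw [← Finset.sum_add_distrib, ← Finset.sum_neg_distrib, ← Finset.sum_add_distrib]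
  exact Finset.sum_congr rfl fun i _ => by ring

/-- Second moment method: the spiked law of an event is controlled by the square root of its
null probability. -/
lemma spikedGOE_apply_le {n : ℕ} (hn : n ≠ 0) {β : ℝ} (hβ : β ^ 2 < 1)
    {A : Set (Matrix (Fin n) (Fin n) ℝ)} (hA : MeasurableSet A) :
    spikedGOE n β A ≤ goe n A ^ (1 / 2 : ℝ) *
      (∫⁻ g, ENNReal.ofReal (Real.exp (β ^ 2 / 2 * g ^ 2)) ∂gaussianReal 0 1) ^ (1 / 2 : ℝ) := by
  set γ := stdGaussianPi (Fin n × Fin n)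
  set B := symmetrize n ⁻¹' A
  have hBm : MeasurableSet B := measurable_symmetrize n hA
  have hBi : Measurable (B.indicator (1 : (Fin n × Fin n → ℝ) → ℝ≥0∞)) :=
    measurable_one.indicator hBm
  have hD : Measurable fun p : (Fin n → ℝ) × (Fin n × Fin n → ℝ) =>
      shiftDensity (spike n β p.1) p.2 := by
    unfold shiftDensity
    fun_prop
  set L : (Fin n × Fin n → ℝ) → ℝ≥0∞ := fun g =>
    ∫⁻ x, shiftDensity (spike n β x) g ∂stdGaussianPi (Fin n)
  have hLm : Measurable L := Measurable.lintegral_prod_left' (μ := stdGaussianPi (Fin n)) hD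
  have hDg : ∀ g, Measurable fun x => shiftDensity (spike n β x) g := fun g => by
    unfold shiftDensity
    fun_prop
  have h1 : spikedGOE n β A = ∫⁻ g, (B.indicator (1 : (Fin n × Fin n → ℝ) → ℝ≥0∞) * L) g ∂γ := by
    rw [spikedGOE_apply hn β hA]
    rw [lintegral_congr fun x => lintegral_stdGaussianPi_add (spike n β x) hBi]
    rw [lintegral_lintegral_swap]
    · refine lintegral_congr fun g => ?_
      rw [lintegral_mul_const _ (hDg g), mul_comm]
      rfl
    · exact (hD.mul (hBi.comp measurable_snd)).aemeasurable
  have h2 : ∫⁻ g, L g ^ (2 : ℝ) ∂γ ≤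
      ∫⁻ g, ENNReal.ofReal (Real.exp (β ^ 2 / 2 * g ^ 2)) ∂gaussianReal 0 1 := by
    have hDD : Measurable fun p : (Fin n × Fin n → ℝ) × (Fin n → ℝ) × (Fin n → ℝ) =>
        shiftDensity (spike n β p.2.1) p.1 * shiftDensity (spike n β p.2.2) p.1 := by
      unfold shiftDensity
      fun_prop
    calc ∫⁻ g, L g ^ (2 : ℝ) ∂γ
        = ∫⁻ g, ∫⁻ p, shiftDensity (spike n β p.1) g * shiftDensity (spike n β p.2) g
            ∂(stdGaussianPi (Fin n)).prod (stdGaussianPi (Fin n)) ∂γ := by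
          refine lintegral_congr fun g => ?_
          rw [lintegral_prod_mul (hDg g).aemeasurable (hDg g).aemeasurable, ENNReal.rpow_two, sq]
      _ = ∫⁻ p, ∫⁻ g, shiftDensity (spike n β p.1) g * shiftDensity (spike n β p.2) g ∂γ
            ∂(stdGaussianPi (Fin n)).prod (stdGaussianPi (Fin n)) :=
          lintegral_lintegral_swap hDD.aemeasurable
      _ = ∫⁻ p, ENNReal.ofReal (Real.exp (β ^ 2 / 2 * Fintype.card (Fin n) *
            ((∑ i, direction p.1 i * p.2 i) ^ 2 / ∑ i, p.2 i ^ 2)))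
            ∂(stdGaussianPi (Fin n)).prod (stdGaussianPi (Fin n)) := by
          refine lintegral_congr fun p => ?_
          rw [lintegral_shiftDensity_mul, sum_spike_mul_spike, sum_mul_direction_sq,
            Fintype.card_fin]
      _ = ∫⁻ x, ∫⁻ y, ENNReal.ofReal (Real.exp (β ^ 2 / 2 * Fintype.card (Fin n) *
            ((∑ i, direction x i * y i) ^ 2 / ∑ i, y i ^ 2)))
            ∂stdGaussianPi (Fin n) ∂stdGaussianPi (Fin n) :=
          lintegral_prod _ (Measurable.aemeasurable (by fun_prop))
      _ ≤ ∫⁻ _, (∫⁻ g, ENNReal.ofReal (Real.exp (β ^ 2 / 2 * g ^ 2)) ∂gaussianReal 0 1)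
            ∂stdGaussianPi (Fin n) :=
          lintegral_mono fun x => lintegral_exp_card_mul_sq_div_le (by positivity) (by linarith)
            _ (sum_direction_sq_le_one x)
      _ = _ := by simp
  have h3 : ∫⁻ g, (B.indicator (1 : (Fin n × Fin n → ℝ) → ℝ≥0∞) g) ^ (2 : ℝ) ∂γ = goe n A := by
    rw [goe_apply hA, ← lintegral_indicator_one hBm]
    refine lintegral_congr fun g => ?_
    by_cases hg : g ∈ B <;> simp [hg, Set.indicator]
  rw [h1]
  refine (ENNReal.lintegral_mul_le_Lp_mul_Lq γ Real.HolderConjugate.two_two hBi.aemeasurable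
    hLm.aemeasurable).trans ?_
  rw [h3]
  gcongr

/-- for `k = 2` and `0 ≤ β < 1`, the laws of `β v vᵀ + Z` (with `v` uniform on the
sphere, `Z` an independent GOE matrix) are contiguous with respect to the laws of `Z`. -/
theorem spiked_goe_contiguous
    (β : ℝ) (hβ0 : 0 ≤ β) (hβ : β < 1)
    (A : ∀ n, Set (Matrix (Fin n) (Fin n) ℝ)) (hA : ∀ n, MeasurableSet (A n))
    (h0 : Tendsto (fun n => goe n (A n)) atTop (nhds 0)) :
    Tendsto (fun n => spikedGOE n β (A n)) atTop (nhds 0) := by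
  have hβ2 : β ^ 2 < 1 := by nlinarith
  set K := ∫⁻ g, ENNReal.ofReal (Real.exp (β ^ 2 / 2 * g ^ 2)) ∂gaussianReal 0 1
  have hK : K ^ (1 / 2 : ℝ) ≠ ∞ :=
    ENNReal.rpow_ne_top_of_nonneg (by norm_num)
      (lintegral_exp_sq_gaussianReal_lt_top (by linarith)).ne
  have hlim : Tendsto (fun n => goe n (A n) ^ (1 / 2 : ℝ) * K ^ (1 / 2 : ℝ)) atTop (nhds 0) := by
    have h := ENNReal.Tendsto.mul_const (h0.ennrpow_const (1 / 2 : ℝ)) (Or.inr hK)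
    simpa using h
  refine tendsto_of_tendsto_of_tendsto_of_le_of_le' tendsto_const_nhds hlim
    (Eventually.of_forall fun _ => zero_le) ?_
  filter_upwards [eventually_ne_atTop 0] with n hn
  exact spikedGOE_apply_le hn hβ2 (hA n)

end
end

section
/- Fix k ≥ 3 and 0 ≤ β < β̄_k, where β̄_k = inf_{q∈(0,1)} √( −(1/q^k) log(1−q²) ). For each n, let Λ_n = dP_β/dP_0 be the Radon–Nikodym derivative of the law P_β of X = β v^{⊗k} + Z (v uniform on S^{n−1}, Z an independent symmetric standard normal k-tensor in ⊗^k ℝ^n) with respect to the law P_0 of Z. Then lim_{n→∞} E_0[Λ_n²] = 1, where E_0 denotes expectation under P_0. -/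
open MeasureTheory ProbabilityTheory Filter
open scoped ENNReal

noncomputable section

/-- Symmetric standard normal noise tensor: `Z = (1/k!)·√(2/n)·Σ_{π∈S_k} G^π`, where `G` has
i.i.d. `N(0,1)` entries and `(G^π)_{i₁…i_k} = G_{i_{π(1)},…,i_{π(k)}}`. -/
def symNoise (k n : ℕ) : Measure ((Fin k → Fin n) → ℝ) :=
  (stdGaussianPi (Fin k → Fin n)).map
    fun g idx => (1 / (Nat.factorial k : ℝ)) * Real.sqrt (2 / n) *
      ∑ π : Equiv.Perm (Fin k), g (idx ∘ π)

/-- Law of the spiked symmetric tensor `X = β v^{⊗k} + Z`, with `v` uniform on the unit sphere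
and `Z` an independent symmetric standard normal tensor. -/
def spikedSymTensor (k n : ℕ) (β : ℝ) : Measure ((Fin k → Fin n) → ℝ) :=
  ((sphereUniform n).prod (symNoise k n)).map
    fun p idx => β * (∏ j, p.1 (idx j)) + p.2 idx

/-- The second-moment threshold `β̄_k = inf_{q∈(0,1)} √(−(1/q^k) log(1−q²))`. -/
def betaBar (k : ℕ) : ℝ :=
  sInf {x : ℝ | ∃ q ∈ Set.Ioo (0 : ℝ) 1, x = Real.sqrt (-(1 / q ^ k) * Real.log (1 - q ^ 2))}

lemma lintegral_exp_quadratic_gaussianReal {a : ℝ} (c : ℝ) (ha : 0 < 1 + 2 * a) :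
    ∫⁻ x, ENNReal.ofReal (Real.exp (c * x - a * x ^ 2)) ∂(gaussianReal 0 1) =
      ENNReal.ofReal ((√(1 + 2 * a))⁻¹ * Real.exp (c ^ 2 / (2 * (1 + 2 * a)))) := by
  set w := 1 + 2 * a with hw
  obtain ⟨v, hvw⟩ : ∃ v : NNReal, (v : ℝ) = w⁻¹ := ⟨⟨w⁻¹, by positivity⟩, rfl⟩
  have hv : v ≠ 0 := by
    rintro rfl
    have : (0 : ℝ) < w⁻¹ := by positivity
    simp [← hvw] at this
  rw [gaussianReal_of_var_ne_zero _ one_ne_zero,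
    lintegral_withDensity_eq_lintegral_mul _ (measurable_gaussianPDF 0 1) (by fun_prop)]
  have key : ∀ x : ℝ, (gaussianPDF 0 1 * fun x => ENNReal.ofReal (Real.exp (c * x - a * x ^ 2))) x
      = ENNReal.ofReal ((√w)⁻¹ * Real.exp (c ^ 2 / (2 * w))) *
        gaussianPDF (c / w) v x := by
    intro x
    simp only [Pi.mul_apply, gaussianPDF]
    rw [← ENNReal.ofReal_mul (gaussianPDFReal_nonneg _ _ _), ← ENNReal.ofReal_mul (by positivity)]
    congr 1
    simp only [gaussianPDFReal, NNReal.coe_one, hvw]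
    have h1 : √(2 * Real.pi * w⁻¹) = √(2 * Real.pi) * (√w)⁻¹ := by
      rw [Real.sqrt_mul (by positivity), Real.sqrt_inv]
    have h2 : √w ≠ 0 := by positivity
    rw [h1, mul_one, mul_inv, inv_inv, mul_assoc, ← Real.exp_add]
    have h3 : (√w)⁻¹ * Real.exp (c ^ 2 / (2 * w)) *
        ((√(2 * Real.pi))⁻¹ * √w * Real.exp (-(x - c / w) ^ 2 / (2 * w⁻¹))) =
        (√(2 * Real.pi))⁻¹ *
          Real.exp (c ^ 2 / (2 * w) + -(x - c / w) ^ 2 / (2 * w⁻¹)) := by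
      rw [Real.exp_add]; field_simp
    rw [h3]
    congr 2
    have : a = (w - 1) / 2 := by rw [hw]; ring
    rw [this]
    field_simp
    ring
  simp_rw [key]
  rw [lintegral_const_mul _ (measurable_gaussianPDF _ _), lintegral_gaussianPDF_eq_one _ hv,
    mul_one]

lemma lintegral_prod_stdGaussianPi {ι : Type*} [Fintype ι] {f : ι → ℝ → ℝ≥0∞}
    (hf : ∀ i, Measurable (f i)) :
    ∫⁻ x, ∏ i, f i (x i) ∂(stdGaussianPi ι) = ∏ i, ∫⁻ t, f i t ∂(gaussianReal 0 1) := by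
  unfold stdGaussianPi
  rw [lintegral_prod_eq_prod_lintegral_of_indepFun Finset.univ (fun i (x : ι → ℝ) => f i (x i))
    (iIndepFun_pi fun i => (hf i).aemeasurable) (fun i => (hf i).comp (measurable_pi_apply i))]
  refine Finset.prod_congr rfl fun i _ => ?_
  rw [← lintegral_map (f := f i) (hf i) (measurable_pi_apply i),
    (measurePreserving_eval (fun _ : ι => gaussianReal 0 1) i).map_eq]

lemma ofReal_exp_sum {ι : Type*} [Fintype ι] (a : ι → ℝ) :
    ENNReal.ofReal (Real.exp (∑ i, a i)) = ∏ i, ENNReal.ofReal (Real.exp (a i)) := by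
  rw [Real.exp_sum, ENNReal.ofReal_prod_of_nonneg fun i _ => (Real.exp_pos _).le]

lemma gaussianReal_withDensity_exp (h : ℝ) :
    (gaussianReal 0 1).withDensity (fun x => ENNReal.ofReal (Real.exp (h * x - h ^ 2 / 2))) =
      gaussianReal h 1 := by
  rw [gaussianReal_of_var_ne_zero _ one_ne_zero, gaussianReal_of_var_ne_zero _ one_ne_zero,
    ← withDensity_mul _ (measurable_gaussianPDF 0 1) (by fun_prop)]
  congr 1
  ext x
  simp only [Pi.mul_apply, gaussianPDF]
  rw [← ENNReal.ofReal_mul (gaussianPDFReal_nonneg _ _ _)]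
  simp only [gaussianPDFReal, NNReal.coe_one]
  rw [mul_assoc, ← Real.exp_add]
  congr 3
  ring

lemma stdGaussianPi_map_add {ι : Type*} [Fintype ι] (h : ι → ℝ) :
    (stdGaussianPi ι).map (fun g i => h i + g i) =
      (stdGaussianPi ι).withDensity
        (fun g => ENNReal.ofReal (Real.exp (∑ i, (h i * g i - h i ^ 2 / 2)))) := by
  have h1 : (stdGaussianPi ι).map (fun g i => h i + g i) =
      Measure.pi fun i => gaussianReal (h i) 1 := by
    unfold stdGaussianPi
    have hm : ∀ i, (gaussianReal 0 1).map (fun x => h i + x) = gaussianReal (h i) 1 := fun i => by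
      rw [gaussianReal_map_const_add, zero_add]
    have : ∀ i, SigmaFinite ((gaussianReal 0 1).map (fun x => h i + x)) := fun i => by
      rw [hm]; infer_instance
    rw [Measure.pi_map_pi (f := fun i x => h i + x) (fun i => by fun_prop)]
    simp_rw [hm]
  rw [h1]
  refine Measure.pi_eq fun s hs => ?_
  rw [withDensity_apply _ (MeasurableSet.univ_pi hs),
    ← lintegral_indicator (MeasurableSet.univ_pi hs)]
  have h2 : ∀ g : ι → ℝ, (Set.pi Set.univ s).indicator
      (fun g => ENNReal.ofReal (Real.exp (∑ i, (h i * g i - h i ^ 2 / 2)))) g =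
      ∏ i, (s i).indicator (fun x => ENNReal.ofReal (Real.exp (h i * x - h i ^ 2 / 2))) (g i) := by
    intro g
    by_cases hg : g ∈ Set.pi Set.univ s
    · rw [Set.indicator_of_mem hg, ofReal_exp_sum]
      exact Finset.prod_congr rfl fun i _ => by rw [Set.indicator_of_mem (hg i trivial)]
    · rw [Set.indicator_of_notMem hg]
      simp only [Set.mem_pi, Set.mem_univ, true_imp_iff, not_forall] at hg
      obtain ⟨i, hi⟩ := hg
      exact (Finset.prod_eq_zero (Finset.mem_univ i) (Set.indicator_of_notMem hi _)).symm
  simp_rw [h2]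
  rw [lintegral_prod_stdGaussianPi (fun i => Measurable.indicator (by fun_prop) (hs i))]
  refine Finset.prod_congr rfl fun i _ => ?_
  rw [lintegral_indicator (hs i), ← withDensity_apply _ (hs i), gaussianReal_withDensity_exp]

lemma lintegral_exp_linear_stdGaussianPi {ι : Type*} [Fintype ι] (h : ι → ℝ) :
    ∫⁻ g, ENNReal.ofReal (Real.exp (∑ i, h i * g i)) ∂(stdGaussianPi ι) =
      ENNReal.ofReal (Real.exp ((∑ i, h i ^ 2) / 2)) := by
  simp_rw [ofReal_exp_sum, Finset.sum_div]
  rw [lintegral_prod_stdGaussianPi (f := fun i t => ENNReal.ofReal (Real.exp (h i * t)))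
    (fun i => by fun_prop), ofReal_exp_sum]
  refine Finset.prod_congr rfl fun i _ => ?_
  simpa using lintegral_exp_quadratic_gaussianReal (a := 0) (h i) (by norm_num)

lemma gaussian_cone_tail {ι : Type*} [Fintype ι] {u : ι → ℝ} (hu : ∑ i, u i ^ 2 = 1)
    {s y : ℝ} (hs0 : 0 < s) (hs1 : s < 1) (hy0 : 0 < y) (hy1 : y ≤ 1) :
    stdGaussianPi ι {x | (1 - y) * ∑ i, x i ^ 2 ≤ (∑ i, u i * x i) ^ 2} ≤
      ENNReal.ofReal ((√(1 - s))⁻¹ * y ^ (s * ((Fintype.card ι : ℝ) - 1) / 2)) := by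
  set m := s / (2 * y) with hm
  have hm0 : 0 < m := by positivity
  set w := 1 + 2 * (m * (1 - y)) with hw
  have hw' : w = 1 + s * (y⁻¹ - 1) := by rw [hw, hm]; field_simp
  have hy1' : 1 ≤ y⁻¹ := (one_le_inv₀ hy0).2 hy1
  have hwpos : 0 < w := by
    have := mul_nonneg hs0.le (sub_nonneg.2 hy1')
    linarith
  have hgap : 1 + 2 * (-(m / w)) = (1 - s) / w := by
    rw [eq_div_iff hwpos.ne']
    field_simp
    rw [hw, hm]
    field_simp
    ring
  have hgap0 : 0 < 1 + 2 * (-(m / w)) := by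
    rw [hgap]; exact div_pos (by linarith) hwpos
  have hsq : √(2 * m) ^ 2 = 2 * m := Real.sq_sqrt (by positivity)
  have hcard : (1 : ℝ) ≤ Fintype.card ι := by
    have : Nonempty ι := by
      by_contra h
      rw [not_nonempty_iff] at h
      simp at hu
    exact_mod_cast Fintype.card_pos
  calc stdGaussianPi ι {x | (1 - y) * ∑ i, x i ^ 2 ≤ (∑ i, u i * x i) ^ 2}
      = ∫⁻ x, {x : ι → ℝ | (1 - y) * ∑ i, x i ^ 2 ≤ (∑ i, u i * x i) ^ 2}.indicator 1 x
          ∂(stdGaussianPi ι) := by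
        rw [lintegral_indicator_one]
        exact measurableSet_le (by fun_prop) (by fun_prop)
    _ ≤ ∫⁻ x, ∫⁻ t, ∏ i, ENNReal.ofReal
          (Real.exp (√(2 * m) * t * u i * x i - m * (1 - y) * x i ^ 2))
          ∂(gaussianReal 0 1) ∂(stdGaussianPi ι) := by
        refine lintegral_mono fun x => ?_
        by_cases hx : (1 - y) * ∑ i, x i ^ 2 ≤ (∑ i, u i * x i) ^ 2
        swap
        · rw [Set.indicator_of_notMem (by exact hx)]
          exact zero_le
        rw [Set.indicator_of_mem (by exact hx)]
        have h1 : ∀ t : ℝ, ∏ i, ENNReal.ofReal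
            (Real.exp (√(2 * m) * t * u i * x i - m * (1 - y) * x i ^ 2)) =
            ENNReal.ofReal (Real.exp (-(m * (1 - y) * ∑ i, x i ^ 2))) *
            ENNReal.ofReal (Real.exp ((√(2 * m) * ∑ i, u i * x i) * t - 0 * t ^ 2)) := by
          intro t
          rw [← ofReal_exp_sum, ← ENNReal.ofReal_mul (Real.exp_pos _).le, ← Real.exp_add,
            Finset.sum_sub_distrib, Finset.mul_sum, Finset.mul_sum, Finset.sum_mul]
          congr 2
          have : ∀ i, √(2 * m) * t * u i * x i = √(2 * m) * (u i * x i) * t := fun i => by ring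
          simp_rw [this]
          ring
        simp_rw [h1]
        rw [lintegral_const_mul _ (by fun_prop),
          lintegral_exp_quadratic_gaussianReal _ (by norm_num),
          ← ENNReal.ofReal_mul (Real.exp_pos _).le, mul_pow, hsq]
        simp only [Pi.one_apply, mul_zero, add_zero, Real.sqrt_one, inv_one, one_mul, mul_one]
        rw [← Real.exp_add, ENNReal.one_le_ofReal]
        refine Real.one_le_exp ?_
        have := mul_le_mul_of_nonneg_left hx hm0.le
        linarith
    _ = ∫⁻ t, ∫⁻ x, ∏ i, ENNReal.ofReal
          (Real.exp (√(2 * m) * t * u i * x i - m * (1 - y) * x i ^ 2))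
          ∂(stdGaussianPi ι) ∂(gaussianReal 0 1) := by
        rw [lintegral_lintegral_swap]
        refine Measurable.aemeasurable ?_
        simp only [Function.uncurry_def]
        fun_prop
    _ = ∫⁻ t, ENNReal.ofReal ((√w)⁻¹ ^ Fintype.card ι) *
          ENNReal.ofReal (Real.exp (0 * t - -(m / w) * t ^ 2)) ∂(gaussianReal 0 1) := by
        refine lintegral_congr fun t => ?_
        rw [lintegral_prod_stdGaussianPi (f := fun i z => ENNReal.ofReal
          (Real.exp (√(2 * m) * t * u i * z - m * (1 - y) * z ^ 2))) (fun i => by fun_prop)]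
        have h1 : ∀ i, ∫⁻ z, ENNReal.ofReal
            (Real.exp (√(2 * m) * t * u i * z - m * (1 - y) * z ^ 2)) ∂(gaussianReal 0 1) =
            ENNReal.ofReal ((√w)⁻¹) *
              ENNReal.ofReal (Real.exp (m / w * t ^ 2 * u i ^ 2)) := fun i => by
          rw [lintegral_exp_quadratic_gaussianReal _ hwpos, ← hw,
            ENNReal.ofReal_mul (by positivity), mul_pow, mul_pow, hsq]
          congr 3
          field_simp
        simp_rw [h1]
        rw [Finset.prod_mul_distrib, Finset.prod_const, Finset.card_univ, ← ofReal_exp_sum,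
          ← Finset.mul_sum, hu, ENNReal.ofReal_pow (by positivity)]
        congr 3
        ring
    _ = ENNReal.ofReal ((√w)⁻¹ ^ Fintype.card ι * (√((1 - s) / w))⁻¹) := by
        rw [lintegral_const_mul _ (by fun_prop),
          lintegral_exp_quadratic_gaussianReal _ hgap0, hgap,
          ← ENNReal.ofReal_mul (by positivity)]
        simp
    _ ≤ _ := by
        refine ENNReal.ofReal_le_ofReal ?_
        rw [Real.sqrt_div (by linarith), inv_div, div_eq_inv_mul, mul_left_comm]
        refine mul_le_mul_of_nonneg_left ?_ (by positivity)
        have hwy : y⁻¹ ^ s ≤ w := by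
          have := rpow_one_add_le_one_add_mul_self (s := y⁻¹ - 1) (by linarith) hs0.le hs1.le
          rw [hw']
          simpa using this
        have e1 : (√w)⁻¹ ^ Fintype.card ι * √w = (w⁻¹) ^ (((Fintype.card ι : ℝ) - 1) / 2) := by
          rw [Real.sqrt_eq_rpow, ← Real.inv_rpow hwpos.le, ← Real.rpow_natCast,
            ← Real.rpow_mul (by positivity)]
          have : w ^ (1 / 2 : ℝ) = w⁻¹ ^ (-(1 / 2) : ℝ) := by
            rw [Real.inv_rpow hwpos.le, Real.rpow_neg hwpos.le, inv_inv]
          rw [this, ← Real.rpow_add (by positivity)]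
          congr 1
          ring
        rw [e1, show s * ((Fintype.card ι : ℝ) - 1) / 2 = s * (((Fintype.card ι : ℝ) - 1) / 2) by ring,
          Real.rpow_mul hy0.le]
        refine Real.rpow_le_rpow (by positivity) ?_ (by linarith)
        rw [← inv_inv (y ^ s), ← Real.inv_rpow hy0.le]
        exact inv_anti₀ (by positivity) hwy

/-- Layer-cake bound: polynomial concentration near `0` controls negative moments. -/
lemma lintegral_inv_rpow_le {Ω : Type*} [MeasurableSpace Ω] {μ : Measure Ω}
    [IsProbabilityMeasure μ] {Y : Ω → ℝ} (hY : Measurable Y) (hY0 : ∀ ω, 0 ≤ Y ω)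
    {C a b : ℝ} (hC : 0 ≤ C) (ha : 0 < a) (hab : a < b)
    (htail : ∀ y, 0 < y → y ≤ 1 → μ {ω | Y ω ≤ y} ≤ ENNReal.ofReal (C * y ^ b)) :
    ∫⁻ ω, ENNReal.ofReal ((Y ω)⁻¹ ^ a) ∂μ ≤ ENNReal.ofReal (1 + C * (a / (b - a))) := by
  rw [lintegral_rpow_eq_lintegral_meas_le_mul μ (Eventually.of_forall fun ω => inv_nonneg.2 (hY0 ω))
    hY.inv.aemeasurable ha, ← Set.Ioc_union_Ioi_eq_Ioi zero_le_one,
    lintegral_union measurableSet_Ioi (Set.Ioc_disjoint_Ioi le_rfl)]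
  have h1 : ∫⁻ t in Set.Ioc (0 : ℝ) 1, μ {ω | t ≤ (Y ω)⁻¹} * ENNReal.ofReal (t ^ (a - 1)) ≤
      ENNReal.ofReal (1 / a) := by
    calc _ ≤ ∫⁻ t in Set.Ioc (0 : ℝ) 1, ENNReal.ofReal (t ^ (a - 1)) := by
          refine lintegral_mono fun t => ?_
          calc _ ≤ 1 * ENNReal.ofReal (t ^ (a - 1)) := by gcongr; exact prob_le_one
            _ = _ := one_mul _
      _ = ENNReal.ofReal (∫ t in Set.Ioc (0 : ℝ) 1, t ^ (a - 1)) := by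
          rw [ofReal_integral_eq_lintegral_ofReal]
          · have := intervalIntegral.intervalIntegrable_rpow' (a := 0) (b := 1) (r := a - 1)
              (by linarith)
            rwa [intervalIntegrable_iff_integrableOn_Ioc_of_le zero_le_one] at this
          · filter_upwards [self_mem_ae_restrict measurableSet_Ioc] with t ht
            exact Real.rpow_nonneg ht.1.le _
      _ = _ := by
          rw [← intervalIntegral.integral_of_le zero_le_one, integral_rpow (Or.inl (by linarith))]
          simp [Real.zero_rpow ha.ne']
  have h2 : ∫⁻ t in Set.Ioi (1 : ℝ), μ {ω | t ≤ (Y ω)⁻¹} * ENNReal.ofReal (t ^ (a - 1)) ≤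
      ENNReal.ofReal (C * (1 / (b - a))) := by
    calc _ ≤ ∫⁻ t in Set.Ioi (1 : ℝ), ENNReal.ofReal (C * t ^ (a - b - 1)) := by
          refine setLIntegral_mono (by fun_prop) fun t ht => ?_
          have ht0 : 0 < t := zero_lt_one.trans ht
          have : {ω | t ≤ (Y ω)⁻¹} ⊆ {ω | Y ω ≤ t⁻¹} := fun ω hω => by
            rcases (hY0 ω).eq_or_lt with h | h
            · change Y ω ≤ t⁻¹
              rw [← h]
              positivity
            · exact (le_inv_comm₀ ht0 h).1 hω
          calc _ ≤ ENNReal.ofReal (C * t⁻¹ ^ b) * ENNReal.ofReal (t ^ (a - 1)) := by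
                gcongr
                exact (measure_mono this).trans
                  (htail _ (by positivity) (inv_le_one_of_one_le₀ (le_of_lt ht)))
            _ = _ := by
                rw [← ENNReal.ofReal_mul (by positivity), mul_assoc, Real.inv_rpow ht0.le,
                  ← Real.rpow_neg ht0.le, ← Real.rpow_add ht0]
                congr 3
                ring
      _ = ENNReal.ofReal (∫ t in Set.Ioi (1 : ℝ), C * t ^ (a - b - 1)) := by
          rw [ofReal_integral_eq_lintegral_ofReal]
          · exact (integrableOn_Ioi_rpow_of_lt (by linarith) zero_lt_one).const_mul _
          · filter_upwards [self_mem_ae_restrict measurableSet_Ioi] with t ht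
            exact mul_nonneg hC (Real.rpow_nonneg (zero_lt_one.trans ht).le _)
      _ = _ := by
          rw [integral_const_mul, integral_Ioi_rpow_of_lt (by linarith) zero_lt_one]
          congr 2
          rw [Real.one_rpow, show a - b - 1 + 1 = -(b - a) by ring, neg_div_neg_eq]
  calc _ ≤ ENNReal.ofReal a * (ENNReal.ofReal (1 / a) + ENNReal.ofReal (C * (1 / (b - a)))) := by
        gcongr
    _ = _ := by
        have : 0 < b - a := by linarith
        rw [← ENNReal.ofReal_add (by positivity) (by positivity), ← ENNReal.ofReal_mul ha.le]
        congr 1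
        field_simp

lemma measurable_normalize (n : ℕ) :
    Measurable fun v : EuclideanSpace ℝ (Fin n) => ‖v‖⁻¹ • v := by
  fun_prop

lemma measurable_toEuclidean (n : ℕ) :
    Measurable fun x : Fin n → ℝ =>
      ((EuclideanSpace.equiv (Fin n) ℝ).symm x : EuclideanSpace ℝ (Fin n)) :=
  (EuclideanSpace.equiv (Fin n) ℝ).symm.continuous.measurable

instance isProbabilityMeasure_sphereUniform (n : ℕ) :
    IsProbabilityMeasure (sphereUniform n) := by
  unfold sphereUniform
  have := Measure.isProbabilityMeasure_map (μ := stdGaussianPi (Fin n))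
    (measurable_toEuclidean n).aemeasurable
  exact Measure.isProbabilityMeasure_map (measurable_normalize n).aemeasurable

lemma ae_norm_eq_one_sphereUniform {n : ℕ} (hn : 0 < n) :
    ∀ᵐ v ∂(sphereUniform n), ‖v‖ = 1 := by
  unfold sphereUniform
  have hne : Nonempty (Fin n) := ⟨⟨0, hn⟩⟩
  rw [ae_map_iff (measurable_normalize n).aemeasurable
      (measurableSet_eq_fun (by fun_prop) (by fun_prop)),
    ae_map_iff (measurable_toEuclidean n).aemeasurable
      (measurableSet_eq_fun (by fun_prop) (by fun_prop))]
  have h0 : ∀ᵐ x ∂(stdGaussianPi (Fin n)), x ≠ 0 := by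
    unfold stdGaussianPi
    have := nullSingletonClass_gaussianReal (μ := 0) (one_ne_zero : (1 : NNReal) ≠ 0)
    simp [ae_iff]
  filter_upwards [h0] with x hx
  rw [norm_smul, norm_inv, norm_norm, inv_mul_cancel₀]
  simpa using hx

/-- The linear map sending a tensor `g` to the rescaled symmetrization defining `symNoise`. -/
def scaledSymmetrize (k n : ℕ) (g : (Fin k → Fin n) → ℝ) (idx : Fin k → Fin n) : ℝ :=
  (1 / (Nat.factorial k : ℝ)) * Real.sqrt (2 / n) * ∑ π : Equiv.Perm (Fin k), g (idx ∘ π)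

/-- The rank-one symmetric tensor `v^{⊗k}`. -/
def tensorPower (k : ℕ) {n : ℕ} (v : EuclideanSpace ℝ (Fin n)) (idx : Fin k → Fin n) : ℝ :=
  ∏ j, v (idx j)

lemma symNoise_eq_map (k n : ℕ) :
    symNoise k n = (stdGaussianPi (Fin k → Fin n)).map (scaledSymmetrize k n) := rfl

@[fun_prop]
lemma measurable_scaledSymmetrize (k n : ℕ) : Measurable (scaledSymmetrize k n) := by
  unfold scaledSymmetrize
  fun_prop

@[fun_prop]
lemma measurable_tensorPower_apply (k : ℕ) {n : ℕ} (idx : Fin k → Fin n) :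
    Measurable fun v : EuclideanSpace ℝ (Fin n) => tensorPower k v idx := by
  unfold tensorPower
  fun_prop

instance isProbabilityMeasure_symNoise (k n : ℕ) : IsProbabilityMeasure (symNoise k n) := by
  rw [symNoise_eq_map]
  exact Measure.isProbabilityMeasure_map (by fun_prop)

lemma tensorPower_comp_perm (k : ℕ) {n : ℕ} (v : EuclideanSpace ℝ (Fin n)) (idx : Fin k → Fin n)
    (π : Equiv.Perm (Fin k)) : tensorPower k v (idx ∘ π) = tensorPower k v idx :=
  Equiv.prod_comp π fun j => v (idx j)

lemma sum_tensorPower_mul (k : ℕ) {n : ℕ} (v w : EuclideanSpace ℝ (Fin n)) :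
    ∑ idx, tensorPower k v idx * tensorPower k w idx = (∑ i, v i * w i) ^ k := by
  rw [Fintype.sum_pow]
  simp [tensorPower, Finset.prod_mul_distrib]

lemma sum_sq_of_norm_eq_one {n : ℕ} {v : EuclideanSpace ℝ (Fin n)} (hv : ‖v‖ = 1) :
    ∑ i, v i ^ 2 = 1 := by
  have := EuclideanSpace.real_norm_sq_eq v
  rw [hv] at this
  linarith

lemma sum_tensorPower_sq (k : ℕ) {n : ℕ} {v : EuclideanSpace ℝ (Fin n)} (hv : ‖v‖ = 1) :
    ∑ idx, tensorPower k v idx ^ 2 = 1 := by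
  have := sum_sq_of_norm_eq_one hv
  simp_rw [sq] at this ⊢
  rw [sum_tensorPower_mul, this, one_pow]

lemma scaledSymmetrize_add_tensorPower (k : ℕ) {n : ℕ} (c : ℝ) (v : EuclideanSpace ℝ (Fin n))
    (g : (Fin k → Fin n) → ℝ) :
    scaledSymmetrize k n (fun idx => c * tensorPower k v idx + g idx) =
      fun idx => √(2 / n) * c * tensorPower k v idx + scaledSymmetrize k n g idx := by
  ext idx
  have : (Nat.factorial k : ℝ) ≠ 0 := by positivity
  simp only [scaledSymmetrize, Finset.sum_add_distrib, tensorPower_comp_perm, Finset.sum_const,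
    Finset.card_univ, Fintype.card_perm, Fintype.card_fin, nsmul_eq_mul]
  field_simp

lemma sum_tensorPower_mul_scaledSymmetrize (k : ℕ) {n : ℕ} (v : EuclideanSpace ℝ (Fin n))
    (g : (Fin k → Fin n) → ℝ) :
    ∑ idx, tensorPower k v idx * scaledSymmetrize k n g idx =
      √(2 / n) * ∑ idx, tensorPower k v idx * g idx := by
  have h1 : ∀ π : Equiv.Perm (Fin k), ∑ idx, tensorPower k v idx * g (idx ∘ π) =
      ∑ idx, tensorPower k v idx * g idx := by
    intro π
    rw [← Equiv.sum_comp (Equiv.arrowCongr π.symm (Equiv.refl (Fin n)))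
      fun idx => tensorPower k v idx * g idx]
    refine Finset.sum_congr rfl fun idx _ => ?_
    have : (Equiv.arrowCongr π.symm (Equiv.refl (Fin n))) idx = idx ∘ π := rfl
    rw [this, tensorPower_comp_perm]
  have : (Nat.factorial k : ℝ) ≠ 0 := by positivity
  simp only [scaledSymmetrize]
  calc _ = (1 / (Nat.factorial k : ℝ)) * √(2 / n) *
        ∑ idx, ∑ π : Equiv.Perm (Fin k), tensorPower k v idx * g (idx ∘ π) := by
        rw [Finset.mul_sum]
        refine Finset.sum_congr rfl fun idx _ => ?_
        rw [← Finset.mul_sum]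
        ring
    _ = _ := by
        rw [Finset.sum_comm]
        simp_rw [h1]
        rw [Finset.sum_const, Finset.card_univ, Fintype.card_perm, Fintype.card_fin, nsmul_eq_mul]
        field_simp

/-- Likelihood ratio of `β v^{⊗k} + Z` against `Z`, for a fixed unit vector `v`. -/
def spikeLikelihood (k n : ℕ) (β : ℝ) (v : EuclideanSpace ℝ (Fin n))
    (x : (Fin k → Fin n) → ℝ) : ℝ≥0∞ :=
  ENNReal.ofReal (Real.exp (β * n / 2 * ∑ idx, tensorPower k v idx * x idx - β ^ 2 * n / 4))

@[fun_prop]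
lemma measurable_spikeLikelihood (k n : ℕ) (β : ℝ) :
    Measurable fun p : EuclideanSpace ℝ (Fin n) × ((Fin k → Fin n) → ℝ) =>
      spikeLikelihood k n β p.1 p.2 := by
  unfold spikeLikelihood
  fun_prop

lemma measurable_spikeLikelihood_left (k n : ℕ) (β : ℝ) (x : (Fin k → Fin n) → ℝ) :
    Measurable fun v => spikeLikelihood k n β v x := by
  unfold spikeLikelihood
  fun_prop

lemma measurable_spikeLikelihood_right (k n : ℕ) (β : ℝ) (v : EuclideanSpace ℝ (Fin n)) :
    Measurable fun x => spikeLikelihood k n β v x := by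
  unfold spikeLikelihood
  fun_prop

lemma lintegral_sq_lintegral {A X : Type*} [MeasurableSpace A] [MeasurableSpace X]
    (σ : Measure A) (ν : Measure X) [SFinite σ] [SFinite ν] {L : A → X → ℝ≥0∞}
    (hL : Measurable (Function.uncurry L)) :
    ∫⁻ x, (∫⁻ v, L v x ∂σ) ^ 2 ∂ν = ∫⁻ v, ∫⁻ w, ∫⁻ x, L v x * L w x ∂ν ∂σ ∂σ := by
  have hx : ∀ x, Measurable fun v => L v x := fun x =>
    hL.comp (measurable_id.prodMk measurable_const)
  have hv : ∀ v, Measurable (L v) := fun v =>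
    hL.comp (measurable_const.prodMk measurable_id)
  have hI : Measurable fun x => ∫⁻ v, L v x ∂σ := Measurable.lintegral_prod_left' hL
  calc _ = ∫⁻ x, ∫⁻ v, L v x * ∫⁻ w, L w x ∂σ ∂σ ∂ν := by
        refine lintegral_congr fun x => ?_
        rw [sq, lintegral_mul_const _ (hx x)]
    _ = ∫⁻ v, ∫⁻ x, L v x * ∫⁻ w, L w x ∂σ ∂ν ∂σ := by
        refine lintegral_lintegral_swap (Measurable.aemeasurable ?_)
        exact (hL.comp measurable_swap).mul (hI.comp measurable_fst)
    _ = ∫⁻ v, ∫⁻ x, ∫⁻ w, L v x * L w x ∂σ ∂ν ∂σ := by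
        refine lintegral_congr fun v => lintegral_congr fun x => ?_
        rw [lintegral_const_mul _ (hx x)]
    _ = _ := by
        refine lintegral_congr fun v => ?_
        refine lintegral_lintegral_swap (Measurable.aemeasurable ?_)
        exact ((hv v).comp measurable_fst).mul (hL.comp measurable_swap)

lemma lintegral_spike_shift {k n : ℕ} (hn : 0 < n) (β : ℝ) {v : EuclideanSpace ℝ (Fin n)}
    (hv : ‖v‖ = 1) {f : ((Fin k → Fin n) → ℝ) → ℝ≥0∞} (hf : Measurable f) :
    ∫⁻ x, f (fun idx => β * tensorPower k v idx + x idx) ∂(symNoise k n) =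
      ∫⁻ x, spikeLikelihood k n β v x * f x ∂(symNoise k n) := by
  have hn' : (0 : ℝ) < n := by exact_mod_cast hn
  have hs : 0 < √(2 / (n : ℝ)) := by positivity
  have hs2 : √(2 / (n : ℝ)) ^ 2 = 2 / n := Real.sq_sqrt (by positivity)
  rw [symNoise_eq_map, lintegral_map (by fun_prop) (by fun_prop),
    lintegral_map (f := fun x => spikeLikelihood k n β v x * f x)
      ((measurable_spikeLikelihood_right k n β v).mul hf) (by fun_prop)]
  set c := β / √(2 / (n : ℝ)) with hc
  have h1 : ∀ g, f (fun idx => β * tensorPower k v idx + scaledSymmetrize k n g idx) =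
      (f ∘ scaledSymmetrize k n) (fun idx => c * tensorPower k v idx + g idx) := by
    intro g
    rw [Function.comp, scaledSymmetrize_add_tensorPower, hc, mul_div_cancel₀ _ hs.ne']
  simp_rw [h1]
  rw [← lintegral_map (f := f ∘ scaledSymmetrize k n)

      (g := fun (g : (Fin k → Fin n) → ℝ) idx => c * tensorPower k v idx + g idx)
      (by fun_prop) (by fun_prop),
    stdGaussianPi_map_add, lintegral_withDensity_eq_lintegral_mul _ (by fun_prop) (by fun_prop)]
  refine lintegral_congr fun g => ?_
  simp only [Pi.mul_apply, Function.comp, spikeLikelihood, sum_tensorPower_mul_scaledSymmetrize]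
  congr 3
  rw [Finset.sum_sub_distrib, ← Finset.sum_div]
  simp_rw [mul_pow, mul_assoc]
  rw [← Finset.mul_sum, ← Finset.mul_sum, sum_tensorPower_sq k hv, hc, div_pow, hs2]
  have : β / √(2 / (n : ℝ)) = β * (n / 2) * √(2 / (n : ℝ)) := by
    rw [div_eq_iff hs.ne', mul_assoc, ← sq, hs2]
    field_simp
  rw [this]
  field_simp
  ring

lemma spikedSymTensor_eq_withDensity {k n : ℕ} (hn : 0 < n) (β : ℝ) :
    spikedSymTensor k n β = (symNoise k n).withDensity
      (fun x => ∫⁻ v, spikeLikelihood k n β v x ∂(sphereUniform n)) := by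
  refine Measure.ext_of_lintegral _ fun f hf => ?_
  have hmeas : Measurable fun p : EuclideanSpace ℝ (Fin n) × ((Fin k → Fin n) → ℝ) =>
      fun idx => β * tensorPower k p.1 idx + p.2 idx := by
    refine measurable_pi_lambda _ fun idx => ?_
    fun_prop
  have h0 : spikedSymTensor k n β = ((sphereUniform n).prod (symNoise k n)).map
      fun p idx => β * tensorPower k p.1 idx + p.2 idx := rfl
  have hL : Measurable fun x => ∫⁻ v, spikeLikelihood k n β v x ∂(sphereUniform n) :=
    Measurable.lintegral_prod_left' (measurable_spikeLikelihood k n β)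
  rw [h0, lintegral_map hf hmeas,
    lintegral_prod (μ := sphereUniform n) (ν := symNoise k n)
      (fun p => f fun idx => β * tensorPower k p.1 idx + p.2 idx) (hf.comp hmeas).aemeasurable,
    lintegral_withDensity_eq_lintegral_mul _ hL hf]
  calc _ = ∫⁻ v, ∫⁻ x, spikeLikelihood k n β v x * f x ∂(symNoise k n) ∂(sphereUniform n) := by
        refine lintegral_congr_ae ?_
        filter_upwards [ae_norm_eq_one_sphereUniform hn] with v hv
        exact lintegral_spike_shift hn β hv hf
    _ = ∫⁻ x, ∫⁻ v, spikeLikelihood k n β v x * f x ∂(sphereUniform n) ∂(symNoise k n) := by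
        refine lintegral_lintegral_swap (Measurable.aemeasurable ?_)
        exact (measurable_spikeLikelihood k n β).mul (hf.comp measurable_snd)
    _ = _ := by
        refine lintegral_congr fun x => ?_
        rw [lintegral_mul_const _ (measurable_spikeLikelihood_left k n β x)]
        rfl

lemma lintegral_spikeLikelihood_mul {k n : ℕ} (hn : 0 < n) (β : ℝ)
    {v w : EuclideanSpace ℝ (Fin n)} (hv : ‖v‖ = 1) (hw : ‖w‖ = 1) :
    ∫⁻ x, spikeLikelihood k n β v x * spikeLikelihood k n β w x ∂(symNoise k n) =
      ENNReal.ofReal (Real.exp (β ^ 2 * n / 2 * (∑ i, v i * w i) ^ k)) := by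
  have hn' : (0 : ℝ) < n := by exact_mod_cast hn
  have hs : 0 < √(2 / (n : ℝ)) := by positivity
  have hs2 : √(2 / (n : ℝ)) ^ 2 = 2 / n := Real.sq_sqrt (by positivity)
  rw [symNoise_eq_map, lintegral_map
    (f := fun x => spikeLikelihood k n β v x * spikeLikelihood k n β w x)
    ((measurable_spikeLikelihood_right k n β v).mul
    (measurable_spikeLikelihood_right k n β w)) (by fun_prop)]
  set c := β * n / 2 * √(2 / (n : ℝ)) with hc
  have h1 : ∀ g, spikeLikelihood k n β v (scaledSymmetrize k n g) *
      spikeLikelihood k n β w (scaledSymmetrize k n g) =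
      ENNReal.ofReal (Real.exp (-(β ^ 2 * n / 2))) * ENNReal.ofReal
        (Real.exp (∑ idx, (c * (tensorPower k v idx + tensorPower k w idx)) * g idx)) := by
    intro g
    simp only [spikeLikelihood, sum_tensorPower_mul_scaledSymmetrize]
    rw [← ENNReal.ofReal_mul (Real.exp_pos _).le, ← ENNReal.ofReal_mul (Real.exp_pos _).le,
      ← Real.exp_add, ← Real.exp_add]
    congr 2
    simp_rw [mul_assoc, add_mul]
    rw [← Finset.mul_sum, Finset.sum_add_distrib, hc]
    ring
  simp_rw [h1]
  rw [lintegral_const_mul _ (by fun_prop), lintegral_exp_linear_stdGaussianPi,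
    ← ENNReal.ofReal_mul (Real.exp_pos _).le, ← Real.exp_add]
  congr 2
  have h2 : ∑ idx, (c * (tensorPower k v idx + tensorPower k w idx)) ^ 2 =
      c ^ 2 * (1 + 2 * (∑ i, v i * w i) ^ k + 1) := by
    rw [← sum_tensorPower_mul]
    nth_rewrite 1 [← sum_tensorPower_sq k hv]
    rw [← sum_tensorPower_sq k hw, Finset.mul_sum, ← Finset.sum_add_distrib,
      ← Finset.sum_add_distrib, Finset.mul_sum]
    exact Finset.sum_congr rfl fun idx _ => by ring
  rw [h2, hc, mul_pow, hs2]
  field_simp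
  ring

lemma second_moment_eq {k n : ℕ} (hn : 0 < n) (β : ℝ) :
    ∫⁻ x, ((spikedSymTensor k n β).rnDeriv (symNoise k n) x) ^ 2 ∂(symNoise k n) =
      ∫⁻ v, ∫⁻ w, ENNReal.ofReal (Real.exp (β ^ 2 * n / 2 * (∑ i, v i * w i) ^ k))
        ∂(sphereUniform n) ∂(sphereUniform n) := by
  have hL : Measurable fun x => ∫⁻ v, spikeLikelihood k n β v x ∂(sphereUniform n) :=
    Measurable.lintegral_prod_left' (measurable_spikeLikelihood k n β)
  have hrn : (spikedSymTensor k n β).rnDeriv (symNoise k n) =ᵐ[symNoise k n]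
      fun x => ∫⁻ v, spikeLikelihood k n β v x ∂(sphereUniform n) := by
    rw [spikedSymTensor_eq_withDensity hn]
    exact Measure.rnDeriv_withDensity _ hL
  calc _ = ∫⁻ x, (∫⁻ v, spikeLikelihood k n β v x ∂(sphereUniform n)) ^ 2 ∂(symNoise k n) := by
        refine lintegral_congr_ae ?_
        filter_upwards [hrn] with x hx
        rw [hx]
    _ = ∫⁻ v, ∫⁻ w, ∫⁻ x, spikeLikelihood k n β v x * spikeLikelihood k n β w x
          ∂(symNoise k n) ∂(sphereUniform n) ∂(sphereUniform n) :=
        lintegral_sq_lintegral _ _ (measurable_spikeLikelihood k n β)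
    _ = _ := by
        refine lintegral_congr_ae ?_
        filter_upwards [ae_norm_eq_one_sphereUniform hn] with v hv
        refine lintegral_congr_ae ?_
        filter_upwards [ae_norm_eq_one_sphereUniform hn] with w hw
        exact lintegral_spikeLikelihood_mul hn β hv hw

lemma sphereUniform_overlap_tail {n : ℕ} {u : EuclideanSpace ℝ (Fin n)} (hu : ‖u‖ = 1)
    {s y : ℝ} (hs0 : 0 < s) (hs1 : s < 1) (hy0 : 0 < y) (hy1 : y ≤ 1) :
    sphereUniform n {w | 1 - (∑ i, u i * w i) ^ 2 ≤ y} ≤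
      ENNReal.ofReal ((√(1 - s))⁻¹ * y ^ (s * ((n : ℝ) - 1) / 2)) := by
  have hm : MeasurableSet {w : EuclideanSpace ℝ (Fin n) | 1 - (∑ i, u i * w i) ^ 2 ≤ y} :=
    measurableSet_le (by fun_prop) (by fun_prop)
  unfold sphereUniform
  rw [Measure.map_apply (measurable_normalize n) hm,
    Measure.map_apply (measurable_toEuclidean n) (measurable_normalize n hm)]
  refine (measure_mono fun x hx => ?_).trans
    ((gaussian_cone_tail (sum_sq_of_norm_eq_one hu) hs0 hs1 hy0 hy1).trans_eq ?_)
  · set X : EuclideanSpace ℝ (Fin n) := (EuclideanSpace.equiv (Fin n) ℝ).symm x with hX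
    have hXi : ∀ i, X i = x i := fun i => rfl
    have hnorm : ‖X‖ ^ 2 = ∑ i, x i ^ 2 := EuclideanSpace.real_norm_sq_eq X
    change 1 - (∑ i, u i * (‖X‖⁻¹ • X) i) ^ 2 ≤ y at hx
    change (1 - y) * ∑ i, x i ^ 2 ≤ (∑ i, u i * x i) ^ 2
    have h1 : ∑ i, u i * (‖X‖⁻¹ • X) i = ‖X‖⁻¹ * ∑ i, u i * x i := by
      rw [Finset.mul_sum]
      refine Finset.sum_congr rfl fun i _ => ?_
      rw [PiLp.smul_apply, smul_eq_mul, hXi]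
      ring
    rw [h1, mul_pow] at hx
    rw [← hnorm]
    rcases (norm_nonneg X).eq_or_lt with h | h
    · rw [← h]
      simp only [ne_eq, OfNat.ofNat_ne_zero, not_false_eq_true, zero_pow, mul_zero]
      positivity
    · have h2 : 1 - y ≤ ‖X‖⁻¹ ^ 2 * (∑ i, u i * x i) ^ 2 := by linarith
      calc (1 - y) * ‖X‖ ^ 2 ≤ ‖X‖⁻¹ ^ 2 * (∑ i, u i * x i) ^ 2 * ‖X‖ ^ 2 := by gcongr
        _ = _ := by field_simp
  · rw [Fintype.card_fin]

lemma sphereUniform_overlap_sq_lt_one {n : ℕ} (hn : 1 < n) {u : EuclideanSpace ℝ (Fin n)}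
    (hu : ‖u‖ = 1) : ∀ᵐ w ∂(sphereUniform n), (∑ i, u i * w i) ^ 2 < 1 := by
  have hn' : (1 : ℝ) < n := by exact_mod_cast hn
  rw [ae_iff]
  have hb : (0 : ℝ) < 1 / 2 * ((n : ℝ) - 1) / 2 := by linarith
  have hlim : Tendsto (fun y : ℝ =>
      ENNReal.ofReal ((√(1 - 1 / 2))⁻¹ * y ^ (1 / 2 * ((n : ℝ) - 1) / 2)))
      (nhdsWithin 0 (Set.Ioi 0)) (nhds 0) := by
    have h1 : ContinuousAt (fun y : ℝ =>
        ENNReal.ofReal ((√(1 - 1 / 2))⁻¹ * y ^ (1 / 2 * ((n : ℝ) - 1) / 2))) 0 :=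
      ENNReal.continuous_ofReal.continuousAt.comp
        (continuousAt_const.mul (Real.continuousAt_rpow_const _ _ (Or.inr hb.le)))
    have h2 := h1.tendsto
    rw [Real.zero_rpow hb.ne', mul_zero, ENNReal.ofReal_zero] at h2
    exact h2.mono_left nhdsWithin_le_nhds
  refine le_antisymm (ge_of_tendsto hlim ?_) zero_le
  filter_upwards [Ioc_mem_nhdsGT (zero_lt_one : (0 : ℝ) < 1)] with y hy
  refine (measure_mono fun w hw => ?_).trans
    (sphereUniform_overlap_tail hu (by norm_num) (by norm_num) hy.1 hy.2)
  have hw' : ¬ (∑ i, u i * w i) ^ 2 < 1 := hw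
  change 1 - (∑ i, u i * w i) ^ 2 ≤ y
  linarith [hy.1]

lemma lintegral_overlap_inv_rpow_le {n : ℕ} {u : EuclideanSpace ℝ (Fin n)} (hu : ‖u‖ = 1)
    {s a : ℝ} (hs0 : 0 < s) (hs1 : s < 1) (ha : 0 < a) (hab : a < s * ((n : ℝ) - 1) / 2) :
    ∫⁻ w, ENNReal.ofReal ((max 0 (1 - (∑ i, u i * w i) ^ 2))⁻¹ ^ a) ∂(sphereUniform n) ≤
      ENNReal.ofReal (1 + (√(1 - s))⁻¹ * (a / (s * ((n : ℝ) - 1) / 2 - a))) := by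
  refine lintegral_inv_rpow_le (by fun_prop) (fun _ => le_max_left _ _) (by positivity) ha hab
    fun y hy0 hy1 => (measure_mono fun w hw => ?_).trans
      (sphereUniform_overlap_tail hu hs0 hs1 hy0 hy1)
  have hw' : max 0 (1 - (∑ i, u i * w i) ^ 2) ≤ y := hw
  exact (le_max_right _ _).trans hw'

lemma abs_exp_sub_one_le_mul_exp (x : ℝ) : |Real.exp x - 1| ≤ |x| * Real.exp |x| := by
  rcases le_total 0 x with h | h
  · rw [abs_of_nonneg h, abs_of_nonneg (sub_nonneg.2 (Real.one_le_exp h))]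
    have h1 := Real.add_one_le_exp (-x)
    have h2 : Real.exp (-x) * Real.exp x = 1 := by rw [← Real.exp_add]; simp
    nlinarith [Real.exp_pos x]
  · rw [abs_of_nonpos (sub_nonpos.2 (Real.exp_le_one_iff.2 h)), abs_of_nonpos h]
    have h1 := Real.add_one_le_exp x
    have h2 : 1 ≤ Real.exp (-x) := Real.one_le_exp (by linarith)
    nlinarith

lemma betaBar_sq_mul_pow_le {k : ℕ} (hB : 0 < betaBar k) {q : ℝ} (hq0 : 0 < q) (hq1 : q < 1) :
    betaBar k ^ 2 * q ^ k ≤ -Real.log (1 - q ^ 2) := by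
  have h : betaBar k ≤ √(-(1 / q ^ k) * Real.log (1 - q ^ 2)) := by
    refine csInf_le ⟨0, ?_⟩ ⟨q, ⟨hq0, hq1⟩, rfl⟩
    rintro x ⟨p, -, rfl⟩
    exact Real.sqrt_nonneg _
  have h2 := (Real.le_sqrt' hB).1 h
  have hqk : 0 < q ^ k := by positivity
  calc _ ≤ -(1 / q ^ k) * Real.log (1 - q ^ 2) * q ^ k := by gcongr
    _ = _ := by field_simp

lemma cube_le_exp {w z δ : ℝ} (hδ : 0 < δ) (hz : δ / 2 * w ^ 2 ≤ z) :
    w ^ 3 ≤ (1 + 8 / δ ^ 2) * Real.exp z := by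
  have h0 : 0 ≤ δ / 2 * w ^ 2 := by positivity
  have h1 := Real.quadratic_le_exp_of_nonneg h0
  have h2 : Real.exp (δ / 2 * w ^ 2) ≤ Real.exp z := Real.exp_le_exp.2 hz
  have h3 : w ^ 3 ≤ 1 + w ^ 4 := by
    nlinarith [sq_nonneg (w ^ 2 - w), sq_nonneg (w - 1), sq_nonneg (w ^ 2 - 1)]
  have h4 : w ^ 4 = 8 / δ ^ 2 * ((δ / 2 * w ^ 2) ^ 2 / 2) := by field_simp; ring
  have h5 : (δ / 2 * w ^ 2) ^ 2 / 2 ≤ Real.exp z := by linarith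
  have h6 : 8 / δ ^ 2 * ((δ / 2 * w ^ 2) ^ 2 / 2) ≤ 8 / δ ^ 2 * Real.exp z := by gcongr
  have h7 : 1 ≤ Real.exp z := Real.one_le_exp (h0.trans hz)
  linarith

lemma abs_exp_overlap_sub_one_le {k : ℕ} (hk : 3 ≤ k) {β r δ : ℝ} (hB : 0 < betaBar k)
    (hr : β ^ 2 = r * betaBar k ^ 2) (hr0 : 0 ≤ r) (hδ : 0 < δ) {n : ℕ} (hn : 0 < n) {T : ℝ}
    (hT : T ^ 2 < 1) :
    |Real.exp (β ^ 2 * n / 2 * T ^ k) - 1| ≤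
      β ^ 2 / 2 * (1 + 8 / δ ^ 2) / √n * (max 0 (1 - T ^ 2))⁻¹ ^ ((r + δ) * n / 2) := by
  have hn' : (0 : ℝ) < n := by exact_mod_cast hn
  have hsn : 0 < √(n : ℝ) := by positivity
  have hsn2 : √(n : ℝ) ^ 2 = n := Real.sq_sqrt hn'.le
  have hZ : 0 < 1 - T ^ 2 := by linarith
  set L := -Real.log (1 - T ^ 2) with hL
  have hLT : T ^ 2 ≤ L := by
    have := Real.log_le_sub_one_of_pos hZ
    linarith
  have hL0 : 0 ≤ L := (sq_nonneg T).trans hLT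
  have hTabs : |T| < 1 := by rwa [← sq_lt_one_iff_abs_lt_one]
  have hpow : (max 0 (1 - T ^ 2))⁻¹ ^ ((r + δ) * n / 2) =
      Real.exp (δ * n * L / 2) * Real.exp (r * n * L / 2) := by
    rw [max_eq_right hZ.le, Real.rpow_def_of_pos (by positivity), Real.log_inv, ← Real.exp_add]
    congr 1
    ring
  have habs : |β ^ 2 * n / 2 * T ^ k| = β ^ 2 * n / 2 * |T| ^ k := by
    rw [abs_mul, abs_pow, abs_of_nonneg (by positivity)]
  have hbd1 : |β ^ 2 * n / 2 * T ^ k| ≤ r * n * L / 2 := by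
    have h1 : betaBar k ^ 2 * |T| ^ k ≤ L := by
      rcases (abs_nonneg T).eq_or_lt with h | h
      · rw [← h, zero_pow (by omega), mul_zero]
        exact hL0
      · have := betaBar_sq_mul_pow_le hB h hTabs
        rwa [sq_abs] at this
    calc |β ^ 2 * n / 2 * T ^ k| = r * n / 2 * (betaBar k ^ 2 * |T| ^ k) := by
          rw [habs, hr]; ring
      _ ≤ r * n / 2 * L := by gcongr
      _ = _ := by ring
  have hbd2 : |β ^ 2 * n / 2 * T ^ k| ≤
      β ^ 2 / 2 * (1 + 8 / δ ^ 2) / √n * Real.exp (δ * n * L / 2) := by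
    have h1 : |T| ^ k ≤ |T| ^ 3 := pow_le_pow_of_le_one (abs_nonneg T) hTabs.le hk
    have h2 : (√(n : ℝ) * |T|) ^ 3 ≤ (1 + 8 / δ ^ 2) * Real.exp (δ * n * L / 2) := by
      refine cube_le_exp hδ ?_
      rw [mul_pow, hsn2, sq_abs]
      calc δ / 2 * (n * T ^ 2) ≤ δ / 2 * (n * L) := by gcongr
        _ = _ := by ring
    calc |β ^ 2 * n / 2 * T ^ k| ≤ β ^ 2 * n / 2 * |T| ^ 3 := by rw [habs]; gcongr
      _ = β ^ 2 / 2 * (√(n : ℝ) * |T|) ^ 3 / √n := by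
          rw [mul_pow, show √(n : ℝ) ^ 3 = √n * √(n : ℝ) ^ 2 by ring, hsn2]
          field_simp
      _ ≤ β ^ 2 / 2 * ((1 + 8 / δ ^ 2) * Real.exp (δ * n * L / 2)) / √n := by gcongr
      _ = _ := by ring
  rw [hpow, ← mul_assoc]
  refine (abs_exp_sub_one_le_mul_exp _).trans ?_
  gcongr

lemma lintegral_abs_exp_overlap_sub_one_le {k : ℕ} (hk : 3 ≤ k) {β r δ s : ℝ}
    (hB : 0 < betaBar k) (hr : β ^ 2 = r * betaBar k ^ 2) (hr0 : 0 ≤ r) (hδ : 0 < δ)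
    (hs : r + δ < s) (hs1 : s < 1) {n : ℕ} (hn : 1 < n)
    (hns : 2 * s ≤ (s - (r + δ)) * n) {v : EuclideanSpace ℝ (Fin n)} (hv : ‖v‖ = 1) :
    ∫⁻ w, ENNReal.ofReal |Real.exp (β ^ 2 * n / 2 * (∑ i, v i * w i) ^ k) - 1|
        ∂(sphereUniform n) ≤
      ENNReal.ofReal (β ^ 2 / 2 * (1 + 8 / δ ^ 2) *
        (1 + (√(1 - s))⁻¹ * (2 * (r + δ) / (s - (r + δ)))) / √n) := by
  have hn' : (0 : ℝ) < n := by exact_mod_cast zero_lt_one.trans hn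
  have hs0 : 0 < s := by linarith
  have hgap : 0 < s - (r + δ) := by linarith
  have hden : (s - (r + δ)) * n / 4 ≤ s * ((n : ℝ) - 1) / 2 - (r + δ) * n / 2 := by linarith
  have hden0 : 0 < (s - (r + δ)) * n / 4 := by positivity
  calc _ ≤ ∫⁻ w, ENNReal.ofReal (β ^ 2 / 2 * (1 + 8 / δ ^ 2) / √n) *
          ENNReal.ofReal ((max 0 (1 - (∑ i, v i * w i) ^ 2))⁻¹ ^ ((r + δ) * n / 2))
          ∂(sphereUniform n) := by
        refine lintegral_mono_ae ?_
        filter_upwards [sphereUniform_overlap_sq_lt_one hn hv] with w hw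
        rw [← ENNReal.ofReal_mul (by positivity)]
        exact ENNReal.ofReal_le_ofReal
          (abs_exp_overlap_sub_one_le hk hB hr hr0 hδ (zero_lt_one.trans hn) hw)
    _ ≤ ENNReal.ofReal (β ^ 2 / 2 * (1 + 8 / δ ^ 2) / √n) *
          ENNReal.ofReal (1 + (√(1 - s))⁻¹ *
            ((r + δ) * n / 2 / (s * ((n : ℝ) - 1) / 2 - (r + δ) * n / 2))) := by
        rw [lintegral_const_mul _ (by fun_prop)]
        gcongr
        exact lintegral_overlap_inv_rpow_le hv hs0 hs1 (by positivity) (by linarith)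
    _ ≤ ENNReal.ofReal (β ^ 2 / 2 * (1 + 8 / δ ^ 2) / √n) *
          ENNReal.ofReal (1 + (√(1 - s))⁻¹ *
            ((r + δ) * n / 2 / ((s - (r + δ)) * n / 4))) := by gcongr
    _ = _ := by
        rw [← ENNReal.ofReal_mul (by positivity)]
        congr 1
        field_simp
        ring

lemma lintegral_lintegral_add {A : Type*} [MeasurableSpace A] (σ : Measure A) [SFinite σ]
    (f : A → A → ℝ≥0∞) {g : A → A → ℝ≥0∞} (hg : Measurable (Function.uncurry g)) :
    ∫⁻ v, ∫⁻ w, f v w + g v w ∂σ ∂σ = ∫⁻ v, ∫⁻ w, f v w ∂σ ∂σ + ∫⁻ v, ∫⁻ w, g v w ∂σ ∂σ := by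
  have hI : Measurable fun v => ∫⁻ w, g v w ∂σ := Measurable.lintegral_prod_right' hg
  rw [← lintegral_add_right _ hI]
  exact lintegral_congr fun v =>
    lintegral_add_right _ (hg.comp (measurable_const.prodMk measurable_id))

/-- for `k ≥ 3` and `0 ≤ β < β̄_k`, the second moment `E_0[Λ_n²]` of the
Radon–Nikodym derivative `Λ_n = dP_β/dP_0` tends to `1`. -/
theorem second_moment_to_one
    (k : ℕ) (hk : 3 ≤ k) (β : ℝ) (hβ0 : 0 ≤ β) (hβ : β < betaBar k) :
    Tendsto
      (fun n => ∫⁻ x, ((spikedSymTensor k n β).rnDeriv (symNoise k n) x) ^ 2 ∂(symNoise k n))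
      atTop (nhds 1) := by
  have hB : 0 < betaBar k := hβ0.trans_lt hβ
  set r := β ^ 2 / betaBar k ^ 2 with hr
  have hr0 : 0 ≤ r := by positivity
  have hr1 : r < 1 := by
    rw [hr, div_lt_one (by positivity)]
    gcongr
  have hβr : β ^ 2 = r * betaBar k ^ 2 := by rw [hr]; field_simp
  set δ := (1 - r) / 3 with hδ
  have hδ0 : 0 < δ := by rw [hδ]; linarith
  set s := r + 2 * δ with hs
  have hs1 : s < 1 := by rw [hs, hδ]; linarith
  set K := β ^ 2 / 2 * (1 + 8 / δ ^ 2) *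
        (1 + (√(1 - s))⁻¹ * (2 * (r + δ) / (s - (r + δ)))) with hK
  have hε : Tendsto (fun n : ℕ => ENNReal.ofReal (K / √n)) atTop (nhds 0) := by
    rw [← ENNReal.ofReal_zero]
    refine ENNReal.tendsto_ofReal (Tendsto.const_div_atTop ?_ K)
    exact Real.tendsto_sqrt_atTop.comp tendsto_natCast_atTop_atTop
  have hlarge : ∀ᶠ n : ℕ in atTop, 1 < n ∧ 2 * s ≤ (s - (r + δ)) * n := by
    refine (eventually_gt_atTop 1).and ?_
    have : 0 < s - (r + δ) := by rw [hs]; linarith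
    exact (tendsto_natCast_atTop_atTop.const_mul_atTop this).eventually_ge_atTop (2 * s)
  have hbound : ∀ᶠ n : ℕ in atTop, ∫⁻ v, ∫⁻ w, ENNReal.ofReal
      |Real.exp (β ^ 2 * n / 2 * (∑ i, v i * w i) ^ k) - 1|
        ∂(sphereUniform n) ∂(sphereUniform n) ≤ ENNReal.ofReal (K / √n) := by
    filter_upwards [hlarge] with n hn
    calc _ ≤ ∫⁻ _, ENNReal.ofReal (K / √n) ∂(sphereUniform n) := by
          refine lintegral_mono_ae ?_
          filter_upwards [ae_norm_eq_one_sphereUniform (zero_lt_one.trans hn.1)] with v hv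
          exact lintegral_abs_exp_overlap_sub_one_le hk hB hβr hr0 hδ0 (by linarith) hs1
            hn.1 hn.2 hv
      _ = _ := by simp
  have hlower : Tendsto (fun n : ℕ => 1 - ENNReal.ofReal (K / √n)) atTop (nhds 1) := by
    simpa using ENNReal.Tendsto.sub (tendsto_const_nhds (x := (1 : ℝ≥0∞))) hε (by simp)
  have hupper : Tendsto (fun n : ℕ => 1 + ENNReal.ofReal (K / √n)) atTop (nhds 1) := by
    simpa using (tendsto_const_nhds (x := (1 : ℝ≥0∞))).add hε
  have hmeas : ∀ n : ℕ, Measurable fun p : EuclideanSpace ℝ (Fin n) × EuclideanSpace ℝ (Fin n) =>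
      ENNReal.ofReal |Real.exp (β ^ 2 * n / 2 * (∑ i, p.1 i * p.2 i) ^ k) - 1| := fun n => by
    fun_prop
  refine tendsto_of_tendsto_of_tendsto_of_le_of_le' hlower hupper ?_ ?_
  · filter_upwards [hlarge, hbound] with n hn hb
    rw [second_moment_eq (zero_lt_one.trans hn.1), tsub_le_iff_right]
    refine le_trans ?_ (add_le_add le_rfl hb)
    rw [← lintegral_lintegral_add _ _ (hmeas n)]
    calc (1 : ℝ≥0∞) = ∫⁻ _, ∫⁻ _, 1 ∂(sphereUniform n) ∂(sphereUniform n) := by simp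
      _ ≤ _ := by
        refine lintegral_mono fun v => lintegral_mono fun w => ?_
        rw [← ENNReal.ofReal_add (Real.exp_pos _).le (abs_nonneg _), ENNReal.one_le_ofReal]
        linarith [neg_abs_le (Real.exp (β ^ 2 * n / 2 * (∑ i, v i * w i) ^ k) - 1)]
  · filter_upwards [hlarge, hbound] with n hn hb
    rw [second_moment_eq (zero_lt_one.trans hn.1)]
    refine le_trans ?_ (add_le_add le_rfl hb)
    calc _ ≤ ∫⁻ v, ∫⁻ w, 1 + ENNReal.ofReal
          |Real.exp (β ^ 2 * n / 2 * (∑ i, v i * w i) ^ k) - 1|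
          ∂(sphereUniform n) ∂(sphereUniform n) := by
          refine lintegral_mono fun v => lintegral_mono fun w => ?_
          rw [← ENNReal.ofReal_one, ← ENNReal.ofReal_add zero_le_one (abs_nonneg _)]
          refine ENNReal.ofReal_le_ofReal ?_
          linarith [le_abs_self (Real.exp (β ^ 2 * n / 2 * (∑ i, v i * w i) ^ k) - 1)]
      _ = _ := by
          rw [lintegral_lintegral_add _ _ (hmeas n)]
          simp

end
end
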